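/- Let M be a subset of ℂⁿ and let p₀ ∈ M be a point of finite type, i.e., Δ(M, p₀) < ∞. Then there exists a neighborhood V₀ of p₀ in ℂⁿ such that Δ(M, p) ≤ 2·(Δ(M, p₀))ⁿ for all p ∈ M ∩ V₀. -/

import Mathlib

open scoped ENNReal Topology

/-- Order of vanishing at `0` of a function `f` between real normed spaces:
the least `m` such that the `m`-th iterated (real) Fréchet derivative of `f` at `0`
is nonzero, and `∞` if all iterated derivatives vanish. -/
noncomputable def vOrder {E F : Type*} [NormedAddCommGroup E] [NormedSpace ℝ E]
    [NormedAddCommGroup F] [NormedSpace ℝ F] (f : E → F) : ℝ≥0∞ :=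
  ⨅ m ∈ {m : ℕ | iteratedFDeriv ℝ m f 0 ≠ 0}, (m : ℝ≥0∞)

/-- `ν(γ)` for a curve `γ : ℂ → ℂⁿ` through `p`: the minimum over the components of
the order of vanishing of `γ i - p i` at `0`. -/
noncomputable def nuCurve {n : ℕ} (γ : ℂ → Fin n → ℂ) (p : Fin n → ℂ) : ℝ≥0∞ :=
  ⨅ i : Fin n, vOrder (fun t => γ t i - p i)

/-- The set `𝒞` of (representatives of) nonconstant germs at `0 ∈ ℂ` of holomorphic
curves `γ` with `γ 0 = p`. -/
def Curves (n : ℕ) (p : Fin n → ℂ) : Set (ℂ → Fin n → ℂ) :=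
  {γ | AnalyticAt ℂ γ 0 ∧ γ 0 = p ∧ ¬ (∀ᶠ t in 𝓝 (0 : ℂ), γ t = p)}

/-- The set `I_M(p)` of (representatives of) germs at `p` of real-valued `C^∞` functions
defined in a neighborhood of `p` and vanishing on `M` near `p`. -/
def IMp (n : ℕ) (M : Set (Fin n → ℂ)) (p : Fin n → ℂ) : Set ((Fin n → ℂ) → ℝ) :=
  {r | ∃ U : Set (Fin n → ℂ), IsOpen U ∧ p ∈ U ∧ ContDiffOn ℝ (⊤ : ℕ∞) r U ∧
    ∀ z ∈ M ∩ U, r z = 0}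

/-- The D'Angelo type `Δ(M,p)` of an arbitrary set `M ⊆ ℂⁿ` at `p`:
`Δ(M,p) = sup_{γ ∈ 𝒞} inf_{r ∈ I_M(p)} ν(r∘γ)/ν(γ)`. -/
noncomputable def Delta (n : ℕ) (M : Set (Fin n → ℂ)) (p : Fin n → ℂ) : ℝ≥0∞ :=
  ⨆ γ ∈ Curves n p, ⨅ r ∈ IMp n M p,
    vOrder (fun t => r (γ t) - r p) / nuCurve γ p

/-- The Taylor polynomial `r_k` of order `k` of `r` at `p`. -/
noncomputable def taylorPoly (n k : ℕ) (r : (Fin n → ℂ) → ℝ) (p : Fin n → ℂ) :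
    (Fin n → ℂ) → ℝ :=
  fun z => ∑ j ∈ Finset.range (k + 1),
    ((j.factorial : ℝ))⁻¹ • iteratedFDeriv ℝ j r p (fun _ => z - p)

/-- `Δ(M_k,p) = sup_{γ ∈ 𝒞} inf_{r ∈ I_M(p)} ν(r_k∘γ)/ν(γ)`. -/
noncomputable def DeltaK (n : ℕ) (M : Set (Fin n → ℂ)) (p : Fin n → ℂ) (k : ℕ) : ℝ≥0∞ :=
  ⨆ γ ∈ Curves n p, ⨅ r ∈ IMp n M p,
    vOrder (fun t => taylorPoly n k r p (γ t) - taylorPoly n k r p p) / nuCurve γ p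

section PolynomialIdeals
open MvPolynomial


section MonicSystem

variable {σ : Type*}

/-- Polynomials all of whose monomials have degree less than `d`. -/
noncomputable def degLT (σ : Type*) (d : ℕ) : Submodule ℂ (MvPolynomial σ ℂ) :=
  restrictSupport ℂ {ρ | ρ.degree < d}

lemma mem_degLT {d : ℕ} {f : MvPolynomial σ ℂ} :
    f ∈ degLT σ d ↔ ∀ ρ ∈ f.support, ρ.degree < d := by
  rw [degLT, mem_restrictSupport_iff]; rfl

lemma degLT_mono {a b : ℕ} (h : a ≤ b) : degLT σ a ≤ degLT σ b := fun f hf => by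
  rw [mem_degLT] at *
  exact fun ρ hρ => (hf ρ hρ).trans_le h

lemma mul_mem_degLT {a b : ℕ} {f h : MvPolynomial σ ℂ} (hf : f ∈ degLT σ (a + 1))
    (hh : h ∈ degLT σ b) : f * h ∈ degLT σ (a + b) := by
  classical
  rw [mem_degLT] at *
  intro ρ hρ
  obtain ⟨u, hu, v, hv, rfl⟩ := Finset.mem_add.1 (support_mul f h hρ)
  have := hf u hu
  have := hh v hv
  rw [map_add]
  omega

lemma monomial_mem_degLT (ρ : σ →₀ ℕ) (c : ℂ) : monomial ρ c ∈ degLT σ (ρ.degree + 1) := by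
  rw [mem_degLT]
  intro u hu
  rw [Finset.mem_singleton.1 (support_monomial_subset hu)]
  exact Nat.lt_succ_self _

lemma degLT_zero {f : MvPolynomial σ ℂ} (hf : f ∈ degLT σ 0) : f = 0 := by
  rw [mem_degLT] at hf
  rw [← support_eq_empty]
  exact Finset.eq_empty_of_forall_notMem fun ρ hρ => by simpa using hf ρ hρ

lemma exists_mem_degLT (f : MvPolynomial σ ℂ) : ∃ d, f ∈ degLT σ d := by
  refine ⟨f.totalDegree + 1, mem_degLT.2 fun ρ hρ => ?_⟩
  have := le_totalDegree hρ
  exact Nat.lt_succ_of_le this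

/-- `f` and `h` have degree at most `a` and the same homogeneous part of degree `a`. -/
def SameTop (a : ℕ) (f h : MvPolynomial σ ℂ) : Prop :=
  f ∈ degLT σ (a + 1) ∧ f - h ∈ degLT σ a

lemma SameTop.right {a : ℕ} {f h : MvPolynomial σ ℂ} (H : SameTop a f h) :
    h ∈ degLT σ (a + 1) := by
  have := Submodule.sub_mem _ H.1 (degLT_mono a.le_succ H.2)
  simpa using this

lemma SameTop.mul {a b : ℕ} {f h f' h' : MvPolynomial σ ℂ} (H : SameTop a f h)
    (H' : SameTop b f' h') : SameTop (a + b) (f * f') (h * h') := by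
  refine ⟨mul_mem_degLT (b := b + 1) H.1 H'.1, ?_⟩
  have h1 := mul_mem_degLT H.1 H'.2
  have h2 := mul_mem_degLT H'.right H.2
  have : f * f' - h * h' = f * (f' - h') + h' * (f - h) := by ring
  rw [this]
  exact Submodule.add_mem _ h1 (by rwa [add_comm a b])

lemma SameTop.one : SameTop 0 (1 : MvPolynomial σ ℂ) 1 := by
  refine ⟨?_, by simp⟩
  simpa using monomial_mem_degLT (0 : σ →₀ ℕ) 1

lemma SameTop.pow {a : ℕ} {f h : MvPolynomial σ ℂ} (H : SameTop a f h) (k : ℕ) :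
    SameTop (k * a) (f ^ k) (h ^ k) := by
  induction k with
  | zero => simpa using SameTop.one
  | succ k ih => rw [pow_succ, pow_succ, Nat.succ_mul]; exact ih.mul H

lemma SameTop.prod {ι : Type*} (s : Finset ι) {a : ι → ℕ} {f h : ι → MvPolynomial σ ℂ}
    (H : ∀ i ∈ s, SameTop (a i) (f i) (h i)) :
    SameTop (∑ i ∈ s, a i) (∏ i ∈ s, f i) (∏ i ∈ s, h i) := by
  classical
  induction s using Finset.induction_on with
  | empty => simpa using SameTop.one
  | insert i s hi ih =>
    rw [Finset.sum_insert hi, Finset.prod_insert hi, Finset.prod_insert hi]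
    exact (H i (by simp)).mul (ih fun j hj => H j (by simp [hj]))

lemma SameTop.X (i : σ) : SameTop 1 (X i : MvPolynomial σ ℂ) (X i) := by
  refine ⟨?_, by simp⟩
  simpa [MvPolynomial.X] using monomial_mem_degLT (Finsupp.single i 1) 1

/-- A system `g i = X i ^ e i + (terms of lower degree)`. -/
def IsMonicSystem (e : σ → ℕ) (g : σ → MvPolynomial σ ℂ) : Prop :=
  ∀ i, 0 < e i ∧ g i - X i ^ e i ∈ degLT σ (e i)

variable {e : σ → ℕ} {g : σ → MvPolynomial σ ℂ}

lemma IsMonicSystem.sameTop (hg : IsMonicSystem e g) (i : σ) :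
    SameTop (e i) (g i) (X i ^ e i) := by
  have h := ((SameTop.X i).pow (e i)).1
  rw [mul_one] at h
  refine ⟨?_, (hg i).2⟩
  have := Submodule.add_mem _ (degLT_mono (Nat.le_succ _) (hg i).2) h
  simpa using this

/-- The ideal generated by all members of the family `g` except the `j`-th. -/
noncomputable def restIdeal (g : σ → MvPolynomial σ ℂ) (j : σ) : Ideal (MvPolynomial σ ℂ) :=
  Ideal.span (Set.range fun i : {i // i ≠ j} => g i)

lemma mem_restIdeal_X_pow {j : σ} {f : MvPolynomial σ ℂ} :
    f ∈ restIdeal (fun i => X i ^ e i) j ↔ ∀ ρ ∈ f.support, ∃ i, i ≠ j ∧ e i ≤ ρ i := by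
  have : restIdeal (fun i => (X i ^ e i : MvPolynomial σ ℂ)) j =
      Ideal.span ((fun s => monomial s (1 : ℂ)) ''
        (Set.range fun i : {i // i ≠ j} => Finsupp.single (i : σ) (e i))) := by
    rw [restIdeal, ← Set.range_comp]
    congr 2
    ext i
    simp [X_pow_eq_monomial]
  rw [this, mem_ideal_span_monomial_image]
  simp [Finsupp.single_le_iff]

variable [Fintype σ]

/-- The linear map sending `X ^ (α + e β)` to `X ^ α * g ^ β`. -/
noncomputable def systemMap (e : σ → ℕ) (g : σ → MvPolynomial σ ℂ) :
    MvPolynomial σ ℂ →ₗ[ℂ] MvPolynomial σ ℂ :=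
  (basisMonomials σ ℂ).constr ℂ fun ρ => ∏ i, (X i ^ (ρ i % e i) * g i ^ (ρ i / e i))

lemma systemMap_monomial (ρ : σ →₀ ℕ) :
    systemMap e g (monomial ρ 1) = ∏ i, (X i ^ (ρ i % e i) * g i ^ (ρ i / e i)) := by
  have := (basisMonomials σ ℂ).constr_basis ℂ
    (fun ρ : σ →₀ ℕ => ∏ i, (X i ^ (ρ i % e i) * g i ^ (ρ i / e i))) ρ
  rwa [coe_basisMonomials] at this

lemma IsMonicSystem.sameTop_systemMap (hg : IsMonicSystem e g) (ρ : σ →₀ ℕ) :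
    SameTop ρ.degree (systemMap e g (monomial ρ 1)) (monomial ρ 1) := by
  have h1 : (monomial ρ 1 : MvPolynomial σ ℂ) =
      ∏ i, (X i ^ (ρ i % e i) * (X i ^ e i) ^ (ρ i / e i)) := by
    rw [monomial_eq, Finsupp.prod_fintype _ _ (by simp)]
    simp only [map_one, one_mul]
    refine Finset.prod_congr rfl fun i _ => ?_
    rw [← pow_mul, ← pow_add, Nat.mod_add_div]
  have h2 : ρ.degree = ∑ i, ((ρ i % e i) * 1 + (ρ i / e i) * e i) := by
    rw [Finsupp.degree_eq_sum]
    refine Finset.sum_congr rfl fun i _ => ?_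
    rw [mul_one, mul_comm, Nat.mod_add_div]
  rw [systemMap_monomial, h1, h2]
  exact SameTop.prod _ fun i _ => ((SameTop.X i).pow _).mul ((hg.sameTop i).pow _)

lemma IsMonicSystem.systemMap_sub_mem (hg : IsMonicSystem e g) {d : ℕ} {f : MvPolynomial σ ℂ}
    (hf : f ∈ degLT σ (d + 1)) : systemMap e g f - f ∈ degLT σ d := by
  conv => enter [2]; rw [f.as_sum]
  rw [map_sum, ← Finset.sum_sub_distrib]
  refine Submodule.sum_mem _ fun ρ hρ => ?_
  have h : (monomial ρ (coeff ρ f) : MvPolynomial σ ℂ) = coeff ρ f • monomial ρ 1 := by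
    simp [smul_monomial]
  rw [h, map_smul, ← smul_sub]
  refine Submodule.smul_mem _ _ (degLT_mono ?_ (hg.sameTop_systemMap ρ).2)
  have := mem_degLT.1 hf ρ hρ
  omega

lemma IsMonicSystem.systemMap_surjective (hg : IsMonicSystem e g) :
    Function.Surjective (systemMap e g) := by
  have key : ∀ d, ∀ f ∈ degLT σ d, ∃ h, systemMap e g h = f := by
    intro d
    induction d with
    | zero => exact fun f hf => ⟨0, by rw [degLT_zero hf, map_zero]⟩
    | succ d ih =>
      intro f hf
      obtain ⟨h, hh⟩ := ih _ (hg.systemMap_sub_mem hf)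
      exact ⟨f - h, by rw [map_sub, hh]; ring⟩
  exact fun f => let ⟨d, hd⟩ := exists_mem_degLT f; key d f hd

lemma IsMonicSystem.systemMap_injective (hg : IsMonicSystem e g) :
    Function.Injective (systemMap e g) := by
  rw [← LinearMap.ker_eq_bot, LinearMap.ker_eq_bot']
  have key : ∀ d, ∀ f ∈ degLT σ d, systemMap e g f = 0 → f = 0 := by
    intro d
    induction d with
    | zero => exact fun f hf _ => degLT_zero hf
    | succ d ih =>
      intro f hf h0
      have := hg.systemMap_sub_mem hf
      rw [h0, zero_sub] at this
      exact ih f (by simpa using Submodule.neg_mem _ this) h0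
  exact fun f => let ⟨d, hd⟩ := exists_mem_degLT f; key d f hd

lemma IsMonicSystem.systemMap_X_pow_mul (hg : IsMonicSystem e g) (j : σ) (f : MvPolynomial σ ℂ) :
    systemMap e g (X j ^ e j * f) = g j * systemMap e g f := by
  classical
  induction f using MvPolynomial.induction_on' with
  | add p q hp hq => rw [mul_add, map_add, hp, hq, map_add, mul_add]
  | monomial ρ c =>
    have h : (monomial ρ c : MvPolynomial σ ℂ) = c • monomial ρ 1 := by simp [smul_monomial]
    rw [h, mul_smul_comm, map_smul, map_smul, mul_smul_comm]
    congr 1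
    rw [X_pow_eq_monomial, monomial_mul, one_mul, systemMap_monomial, systemMap_monomial,
      ← Finset.mul_prod_erase Finset.univ _ (Finset.mem_univ j),
      ← Finset.mul_prod_erase Finset.univ (fun i => X i ^ (ρ i % e i) * g i ^ (ρ i / e i))
        (Finset.mem_univ j)]
    have h1 : ∀ i ∈ Finset.univ.erase j,
        (X i ^ ((Finsupp.single j (e j) + ρ) i % e i) * g i ^ ((Finsupp.single j (e j) + ρ) i / e i)
          : MvPolynomial σ ℂ) = X i ^ (ρ i % e i) * g i ^ (ρ i / e i) := by
      intro i hi
      simp [(Finset.ne_of_mem_erase hi).symm]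
    rw [Finset.prod_congr rfl h1]
    simp only [Finsupp.add_apply, Finsupp.single_eq_same, Nat.add_mod_left,
      Nat.add_div_left _ (hg j).1, pow_succ]
    ring

lemma IsMonicSystem.systemMap_mem_iff (hg : IsMonicSystem e g) (j : σ) (f : MvPolynomial σ ℂ) :
    systemMap e g f ∈ restIdeal g j ↔ f ∈ restIdeal (fun i => X i ^ e i) j := by
  classical
  constructor
  · intro h
    obtain ⟨c, hc⟩ := Ideal.mem_span_range_iff_exists_fun.1 h
    choose b hb using fun i => hg.systemMap_surjective (c i)
    have : f = ∑ i, b i * X (i : σ) ^ e i := by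
      apply hg.systemMap_injective
      rw [← hc, map_sum]
      refine Finset.sum_congr rfl fun i _ => ?_
      rw [mul_comm (b i), hg.systemMap_X_pow_mul, hb, mul_comm]
    exact Ideal.mem_span_range_iff_exists_fun.2 ⟨b, this.symm⟩
  · intro h
    obtain ⟨b, hb⟩ := Ideal.mem_span_range_iff_exists_fun.1 h
    refine Ideal.mem_span_range_iff_exists_fun.2 ⟨fun i => systemMap e g (b i), ?_⟩
    rw [← hb, map_sum]
    refine Finset.sum_congr rfl fun i _ => ?_
    rw [mul_comm (b i), hg.systemMap_X_pow_mul, mul_comm]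

/-- In a monic system, each member is a nonzerodivisor modulo the others. -/
lemma IsMonicSystem.mem_of_mul_mem (hg : IsMonicSystem e g) (j : σ) {a : MvPolynomial σ ℂ}
    (h : g j * a ∈ restIdeal g j) : a ∈ restIdeal g j := by
  classical
  obtain ⟨b, rfl⟩ := hg.systemMap_surjective a
  rw [← hg.systemMap_X_pow_mul, hg.systemMap_mem_iff, mem_restIdeal_X_pow] at h
  rw [hg.systemMap_mem_iff, mem_restIdeal_X_pow]
  intro ρ hρ
  obtain ⟨i, hi, hle⟩ := h (Finsupp.single j (e j) + ρ) (by
    rw [mem_support_iff, X_pow_eq_monomial, coeff_monomial_mul, one_mul]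
    exact mem_support_iff.1 hρ)
  exact ⟨i, hi, by simpa [Finsupp.single_apply, hi.symm] using hle⟩

/-- Modulo the other members of a monic system, all polynomials are integral over `ℂ[g j]`. -/
lemma IsMonicSystem.finite_quotient (hg : IsMonicSystem e g) (j : σ) :
    (Polynomial.aeval (R := ℂ) (Ideal.Quotient.mk (restIdeal g j) (g j))).toRingHom.Finite := by
  classical
  set φ := (Polynomial.aeval (R := ℂ) (Ideal.Quotient.mk (restIdeal g j) (g j))).toRingHom
  let _ := φ.toAlgebra
  let S : Finset (MvPolynomial σ ℂ ⧸ restIdeal g j) :=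
    (Fintype.piFinset fun i => Finset.range (e i)).image
      fun α => Ideal.Quotient.mk _ (∏ i, X i ^ α i)
  refine ⟨⟨S, ?_⟩⟩
  rw [eq_top_iff]
  rintro x -
  obtain ⟨f, rfl⟩ := Ideal.Quotient.mk_surjective x
  obtain ⟨b, rfl⟩ := hg.systemMap_surjective f
  induction b using MvPolynomial.induction_on' with
  | add p q hp hq => rw [map_add, map_add]; exact Submodule.add_mem _ hp hq
  | monomial ρ c =>
    have h : (monomial ρ c : MvPolynomial σ ℂ) = c • monomial ρ 1 := by simp [smul_monomial]
    rw [h, map_smul, systemMap_monomial, Finset.prod_mul_distrib, smul_eq_C_mul, map_mul, map_mul]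
    by_cases hβ : ∃ i, i ≠ j ∧ ρ i / e i ≠ 0
    · obtain ⟨i, hi, hβ⟩ := hβ
      have : Ideal.Quotient.mk (restIdeal g j) (∏ i, g i ^ (ρ i / e i)) = 0 := by
        rw [Ideal.Quotient.eq_zero_iff_mem]
        refine Ideal.mem_of_dvd _ ((dvd_pow_self _ hβ).trans
          (Finset.dvd_prod_of_mem (fun i => g i ^ (ρ i / e i)) (Finset.mem_univ i))) ?_
        exact Ideal.subset_span ⟨⟨i, hi⟩, rfl⟩
      rw [this]; simp
    · push Not at hβ
      have h1 : ∏ i, g i ^ (ρ i / e i) = g j ^ (ρ j / e j) :=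
        Finset.prod_eq_single j (fun i _ hi => by rw [hβ i hi, pow_zero]) (by simp)
      have h2 : Ideal.Quotient.mk (restIdeal g j) (C c) *
          (Ideal.Quotient.mk (restIdeal g j) (∏ i, X i ^ (ρ i % e i)) *
            Ideal.Quotient.mk (restIdeal g j) (∏ i, g i ^ (ρ i / e i))) =
          (Polynomial.C c * Polynomial.X ^ (ρ j / e j)) •
            Ideal.Quotient.mk (restIdeal g j) (∏ i, X i ^ (ρ i % e i)) := by
        rw [h1, Algebra.smul_def, RingHom.algebraMap_toAlgebra]
        simp only [φ, AlgHom.toRingHom_eq_coe, RingHom.coe_coe, map_mul, Polynomial.aeval_C,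
          map_pow, Polynomial.aeval_X]
        have : algebraMap ℂ (MvPolynomial σ ℂ ⧸ restIdeal g j) c =
            Ideal.Quotient.mk (restIdeal g j) (C c) := rfl
        rw [this]; ring
      rw [h2]
      refine Submodule.smul_mem _ _ (Submodule.subset_span ?_)
      simp only [S, Finset.coe_image, Set.mem_image, Finset.mem_coe, Fintype.mem_piFinset,
        Finset.mem_range]
      exact ⟨fun i => ρ i % e i, fun i => Nat.mod_lt _ (hg i).1, rfl⟩

end MonicSystem

section Length

variable {A : Type*} [CommRing A] [Algebra ℂ A]

open Pointwise in
lemma length_quotient_span_mul {a b : A} (hb : b ∈ nonZeroDivisors A) :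
    Module.length ℂ (A ⧸ Ideal.span {a * b}) =
      Module.length ℂ (A ⧸ Ideal.span {a}) + Module.length ℂ (A ⧸ Ideal.span {b}) := by
  have h := Module.length_eq_add_of_exact
    ((Ideal.mulQuot b (Ideal.span {a})).restrictScalars ℂ)
    ((Ideal.quotOfMul b (Ideal.span {a})).restrictScalars ℂ)
    (Ideal.mulQuot_injective _ hb) (Ideal.quotOfMul_surjective _)
    (Ideal.exact_mulQuot_quotOfMul _)
  have lem : b • Ideal.span {a} = Ideal.span {a * b} := by
    rw [← Submodule.singleton_set_smul, ← Ideal.submodule_span_eq, Submodule.set_smul_span]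
    simp [mul_comm]
  rwa [lem] at h

lemma length_quotient_span_pow {a : A} (ha : a ∈ nonZeroDivisors A) (k : ℕ) :
    Module.length ℂ (A ⧸ Ideal.span {a ^ k}) = k * Module.length ℂ (A ⧸ Ideal.span {a}) := by
  induction k with
  | zero =>
    have : Subsingleton (A ⧸ Ideal.span {a ^ 0}) := by
      rw [pow_zero, Ideal.span_singleton_one]; exact Ideal.Quotient.subsingleton_iff.2 rfl
    simp
  | succ k ih =>
    rw [pow_succ, length_quotient_span_mul ha, ih]
    push_cast
    rw [add_mul, one_mul]

lemma length_quotient_le_of_le {I J : Ideal A} (h : I ≤ J) :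
    Module.length ℂ (A ⧸ J) ≤ Module.length ℂ (A ⧸ I) :=
  Module.length_le_of_surjective (Ideal.Quotient.factorₐ ℂ h).toLinearMap
    (Ideal.Quotient.factor_surjective h)

/-- If `x ^ (q m)` divides `y ^ (p (m + N))` for all `m`, then `q D(x) ≤ p D(y)`. -/
lemma length_le_of_forall_dvd {x y : A} (hx : x ∈ nonZeroDivisors A) (hy : y ∈ nonZeroDivisors A)
    {p q N : ℕ} (hq : 0 < q) (h : ∀ m, (x ^ q) ^ m ∣ (y ^ p) ^ (m + N)) {D : ℕ}
    (hD : Module.length ℂ (A ⧸ Ideal.span {y}) = D) :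
    ∃ D' : ℕ, Module.length ℂ (A ⧸ Ideal.span {x}) = D' ∧ q * D' ≤ p * D := by
  have key : ∀ m : ℕ, ((q * m : ℕ) : ℕ∞) * Module.length ℂ (A ⧸ Ideal.span {x}) ≤
      ((p * (m + N) * D : ℕ) : ℕ∞) := by
    intro m
    have := length_quotient_le_of_le (Ideal.span_singleton_le_span_singleton.2 (h m))
    rw [← pow_mul, ← pow_mul, length_quotient_span_pow hx, length_quotient_span_pow hy, hD] at this
    exact_mod_cast this
  have hfin : Module.length ℂ (A ⧸ Ideal.span {x}) ≠ ⊤ := by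
    intro htop
    have := key 1
    rw [htop, ENat.mul_top (by simpa using hq.ne')] at this
    exact (ENat.natCast_ne_top _) (top_le_iff.1 this)
  obtain ⟨D', hD'⟩ := ENat.ne_top_iff_exists.1 hfin
  refine ⟨D', hD'.symm, ?_⟩
  by_contra! hlt
  have h1 := key (p * N * D + 1)
  rw [← hD'] at h1
  norm_cast at h1
  have h2 := Nat.mul_le_mul_left (p * N * D + 1) (Nat.succ_le_of_lt hlt)
  rw [Nat.succ_eq_add_one] at h2
  linarith

end Length

section Integral

variable {A : Type*} [CommRing A]

lemma exists_pow_dvd_of_scaleRoots_eval_eq_zero {u v : A} {f : Polynomial A} (hf : f.Monic)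
    (h : (f.scaleRoots u).eval v = 0) : ∃ N, ∀ m, u ^ m ∣ v ^ (m + N) := by
  set d := f.natDegree
  let J : ℕ → Ideal A := fun m => Ideal.span ((fun i => u ^ (d + m - i) * v ^ i) '' Set.Iio d)
  have hrel : v ^ d = -∑ i ∈ Finset.range d, f.coeff i * u ^ (d - i) * v ^ i := by
    rw [Polynomial.eval_eq_sum_range, Polynomial.natDegree_scaleRoots,
      Finset.sum_range_succ] at h
    simp only [Polynomial.coeff_scaleRoots, hf.coeff_natDegree, one_mul, Nat.sub_self,
      pow_zero] at h
    exact eq_neg_of_add_eq_zero_right h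
  have hd : ∀ m, u ^ m * v ^ d ∈ J m := by
    intro m
    rw [hrel, mul_neg, Finset.mul_sum]
    refine neg_mem (Ideal.sum_mem _ fun i hi => ?_)
    have hi := Finset.mem_range.1 hi
    have : u ^ m * (f.coeff i * u ^ (d - i) * v ^ i) = f.coeff i * (u ^ (d + m - i) * v ^ i) := by
      rw [show d + m - i = m + (d - i) by omega, pow_add]; ring
    rw [this]
    exact Ideal.mul_mem_left _ _ (Ideal.subset_span ⟨i, hi, rfl⟩)
  have hstep : ∀ m, ∀ w ∈ J m, v * w ∈ J (m + 1) := by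
    intro m w hw
    refine Submodule.span_induction ?_ (by simp) (fun a b _ _ ha hb => ?_) (fun a b _ hb => ?_) hw
    · rintro _ ⟨i, hi, rfl⟩
      have hi : i < d := hi
      have h1 : v * (u ^ (d + m - i) * v ^ i) = u ^ (d + (m + 1) - (i + 1)) * v ^ (i + 1) := by
        rw [show d + (m + 1) - (i + 1) = d + m - i by omega]; ring
      simp only
      rw [h1]
      rcases (Nat.succ_le_of_lt hi).eq_or_lt with h2 | h2
      · rw [show i + 1 = d from h2, show d + (m + 1) - d = m + 1 by omega]
        exact hd _
      · exact Ideal.subset_span ⟨i + 1, h2, rfl⟩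
    · rw [mul_add]; exact add_mem ha hb
    · rw [smul_eq_mul, mul_left_comm]; exact Ideal.mul_mem_left _ _ hb
  have hmem : ∀ m, v ^ (m + d) ∈ J m := by
    intro m
    induction m with
    | zero => simpa using hd 0
    | succ m ih =>
      rw [show m + 1 + d = (m + d) + 1 by ring, pow_succ']
      exact hstep _ _ ih
  refine ⟨d, fun m => Ideal.mem_span_singleton.1 (Ideal.span_le.2 ?_ (hmem m))⟩
  rintro _ ⟨i, hi, rfl⟩
  have hi : i < d := hi
  exact Ideal.mem_span_singleton.2 ((pow_dvd_pow _ (by omega)).mul_right _)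

lemma exists_scaleRoots_eval_mem_of_isIntegral {P : Ideal A} [P.IsPrime] {u v : A} (hu : u ∉ P)
    (h : IsIntegral (A ⧸ P) (algebraMap (A ⧸ P) (FractionRing (A ⧸ P)) (Ideal.Quotient.mk P v) /
      algebraMap (A ⧸ P) (FractionRing (A ⧸ P)) (Ideal.Quotient.mk P u))) :
    ∃ f : Polynomial A, f.Monic ∧ (f.scaleRoots u).eval v ∈ P := by
  obtain ⟨g, hg, hgv⟩ := h
  obtain ⟨f, rfl, -, hf⟩ := Polynomial.lifts_and_degree_eq_and_monic
    ((Polynomial.lifts_iff_coeff_lifts _).2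
      fun n => Ideal.Quotient.mk_surjective (I := P) (g.coeff n)) hg
  refine ⟨f, hf, ?_⟩
  have hu' : Ideal.Quotient.mk P u ∈ nonZeroDivisors (A ⧸ P) := by
    rwa [mem_nonZeroDivisors_iff_ne_zero, Ne, Ideal.Quotient.eq_zero_iff_mem]
  have := Polynomial.scaleRoots_eval₂_eq_zero_of_eval₂_div_eq_zero
    (IsFractionRing.injective (A ⧸ P) (FractionRing (A ⧸ P))) hgv hu'
  rw [← Polynomial.map_scaleRoots _ _ _ (by simp [hf.leadingCoeff]), Polynomial.eval₂_map,
    ← RingHom.comp_apply, Polynomial.eval₂_hom, RingHom.comp_apply,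
    FaithfulSMul.algebraMap_eq_zero_iff] at this
  exact Ideal.Quotient.eq_zero_iff_mem.1 this

/-- If `v / u` is integral over `A / P` for every minimal prime `P`, then `v ^ (m + N)` is
divisible by `u ^ m`, with `N` independent of `m`. -/
lemma exists_pow_dvd_of_isIntegral [IsNoetherianRing A] [Nontrivial A] {u v : A}
    (hu : ∀ P ∈ minimalPrimes A, u ∉ P)
    (h : ∀ (P : Ideal A) [P.IsPrime], P ∈ minimalPrimes A →
      IsIntegral (A ⧸ P) (algebraMap (A ⧸ P) (FractionRing (A ⧸ P)) (Ideal.Quotient.mk P v) /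
      algebraMap (A ⧸ P) (FractionRing (A ⧸ P)) (Ideal.Quotient.mk P u))) :
    ∃ N, ∀ m, u ^ m ∣ v ^ (m + N) := by
  classical
  have key : ∀ P : minimalPrimes A,
      ∃ f : Polynomial A, f.Monic ∧ (f.scaleRoots u).eval v ∈ (P : Ideal A) := fun P =>
    have := P.2.1.1
    exists_scaleRoots_eval_mem_of_isIntegral (hu _ P.2) (h _ P.2)
  choose f hf hfv using key
  have hfin : Finite (minimalPrimes A) := minimalPrimes.finite_of_isNoetherianRing A
  cases nonempty_fintype (minimalPrimes A)
  have hmul : ∀ s : Finset (minimalPrimes A), ((∏ P ∈ s, f P).scaleRoots u) =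
      ∏ P ∈ s, (f P).scaleRoots u := by
    intro s
    induction s using Finset.induction_on with
    | empty => simp
    | insert P s hP ih =>
      rw [Finset.prod_insert hP, Finset.prod_insert hP, Polynomial.mul_scaleRoots', ih]
      rw [(hf P).leadingCoeff, (Polynomial.monic_prod_of_monic _ _ fun i _ => hf i).leadingCoeff]
      simp
  have hnil : ((∏ P, f P).scaleRoots u).eval v ∈ nilradical A := by
    rw [nilradical_eq_sInf, Ideal.mem_sInf]
    intro Q hQ
    have := hQ.out
    obtain ⟨P, hP, hPQ⟩ := Ideal.exists_minimalPrimes_le (I := ⊥) (J := Q) bot_le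
    rw [hmul, Polynomial.eval_prod]
    refine hPQ (Ideal.mem_of_dvd _ (Finset.dvd_prod_of_mem _ (Finset.mem_univ ⟨P, hP⟩))
      (hfv ⟨P, hP⟩))
  obtain ⟨k, hk⟩ := hnil
  have hmon := Polynomial.monic_prod_of_monic Finset.univ f fun i _ => hf i
  refine exists_pow_dvd_of_scaleRoots_eval_eq_zero (hmon.pow k) ?_
  rw [Polynomial.pow_scaleRoots', Polynomial.eval_pow, hk]
  simp [hmon.leadingCoeff]

end Integral

section Valuation

open IsLocalRing Algebra in
/-- An element which is not integral over a local ring is avoided by some dominating valuation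
ring. -/
lemma exists_valuationSubring_of_not_isIntegral {R K : Type*} [CommRing R] [IsLocalRing R]
    [Field K] [Algebra R K] {x : K} (hx : ¬ IsIntegral R x) :
    ∃ V : ValuationSubring K, (∀ r : R, algebraMap R K r ∈ V) ∧
      (∀ r ∈ maximalIdeal R, algebraMap R K r ∈ V.nonunits) ∧ x ∉ V := by
  have hx0 : x ≠ 0 := by rintro rfl; exact hx isIntegral_zero
  let := invertibleOfNonzero hx0
  let B := Algebra.adjoin R {x⁻¹}
  let xinv : B := ⟨x⁻¹, subset_adjoin rfl⟩
  have : (maximalIdeal R).map (algebraMap R B) ⊔ .span {xinv} ≠ ⊤ := by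
    intro eq
    obtain ⟨p, hp, hpx⟩ := exists_aeval_invOf_eq_zero_of_idealMap_adjoin_sup_span_eq_top _ _
      (maximalIdeal.isMaximal R).ne_top eq
    have H : IsUnit p.leadingCoeff := of_not_not fun h => by
      simpa using sub_mem ((mem_maximalIdeal _).2 h) hp
    refine hx ⟨.C H.unit⁻¹.1 * p, ?_, ?_⟩
    · rw [Polynomial.Monic, Polynomial.leadingCoeff_C_mul_of_isUnit (Units.isUnit _)]
      exact H.val_inv_mul
    rw [← Polynomial.aeval_def]
    simpa using .inr hpx
  obtain ⟨V, hV⟩ := Ideal.image_subset_nonunits_valuationSubring (A := B.toSubring) _ this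
  refine ⟨V, fun r => hV.1 (B.algebraMap_mem r), fun r hr => ?_,
    (V.inv_mem_nonunits_iff.mp <|
      hV.2 ⟨xinv, le_sup_right (α := Ideal B) (Ideal.subset_span rfl), rfl⟩).resolve_left hx0⟩
  exact hV.2 ⟨algebraMap R B r, le_sup_left (α := Ideal B) (Ideal.mem_map_of_mem _ hr), rfl⟩

end Valuation

section Place

variable {B : Type*} [CommRing B] [IsDedekindDomain B] {𝔭 : Ideal B}

lemma mem_pow_iff_le_emultiplicity {b : B} {k : ℕ} :
    b ∈ 𝔭 ^ k ↔ (k : ℕ∞) ≤ emultiplicity 𝔭 (Ideal.span {b}) := by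
  rw [← pow_dvd_iff_le_emultiplicity, Ideal.dvd_span_singleton]

lemma emultiplicity_span_mul (hp : Prime 𝔭) (a b : B) :
    emultiplicity 𝔭 (Ideal.span {a * b}) =
      emultiplicity 𝔭 (Ideal.span {a}) + emultiplicity 𝔭 (Ideal.span {b}) := by
  rw [← Ideal.span_singleton_mul_span_singleton, emultiplicity_mul hp]

lemma emultiplicity_span_pow (hp : Prime 𝔭) (a : B) (k : ℕ) :
    emultiplicity 𝔭 (Ideal.span {a ^ k}) = k * emultiplicity 𝔭 (Ideal.span {a}) := by
  rw [← Ideal.span_singleton_pow, emultiplicity_pow hp]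

lemma exists_mem_pow_notMem_pow_succ (hp : Prime 𝔭) {b : B} (hb : b ≠ 0) :
    ∃ a, b ∈ 𝔭 ^ a ∧ b ∉ 𝔭 ^ (a + 1) := by
  have : FiniteMultiplicity 𝔭 (Ideal.span {b}) :=
    FiniteMultiplicity.of_prime_left hp (by simpa using hb)
  obtain ⟨n, hn⟩ := ENat.ne_top_iff_exists.1 (finiteMultiplicity_iff_emultiplicity_ne_top.1 this)
  refine ⟨n, ?_, ?_⟩
  · rw [mem_pow_iff_le_emultiplicity, ← hn]
  · rw [mem_pow_iff_le_emultiplicity, ← hn]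
    norm_cast
    omega

variable [Algebra ℂ B]

lemma exists_curve_approx (hp : Prime 𝔭) (hres : ∀ b : B, ∃ c : ℂ, b - algebraMap ℂ B c ∈ 𝔭)
    {ϖ : B} (h1 : ϖ ∈ 𝔭) (h2 : ϖ ∉ 𝔭 ^ 2) {b : B} (hb : b ∈ 𝔭) (L : ℕ) :
    ∃ γ : Polynomial ℂ, γ.coeff 0 = 0 ∧ b - Polynomial.aeval ϖ γ ∈ 𝔭 ^ (L + 1) := by
  have hϖ : emultiplicity 𝔭 (Ideal.span {ϖ}) = 1 := by
    have h3 : (1 : ℕ∞) ≤ emultiplicity 𝔭 (Ideal.span {ϖ}) := by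
      simpa using mem_pow_iff_le_emultiplicity (k := 1).1 (by simpa using h1)
    rw [mem_pow_iff_le_emultiplicity] at h2
    refine le_antisymm ?_ h3
    exact Order.le_of_lt_add_one (by simpa [one_add_one_eq_two] using h2)
  induction L with
  | zero => exact ⟨0, by simp, by simpa using hb⟩
  | succ L ih =>
    obtain ⟨γ, h0, hγ⟩ := ih
    have hmem : ϖ ^ (L + 1) ∈ 𝔭 ^ (L + 1) := Ideal.pow_mem_pow h1 _
    have hnot : ϖ ^ (L + 1) ∉ 𝔭 ^ (L + 1 + 1) := by
      rw [mem_pow_iff_le_emultiplicity, emultiplicity_span_pow hp, hϖ, mul_one]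
      norm_cast
      omega
    have : 𝔭.IsPrime := Ideal.isPrime_of_prime hp
    obtain ⟨d, e, he, hde⟩ := Ideal.exists_mul_add_mem_pow_succ hp.ne_zero _ _ hmem hnot hγ
    obtain ⟨c, hc⟩ := hres d
    refine ⟨γ + Polynomial.C c * Polynomial.X ^ (L + 1), by simp [h0], ?_⟩
    have : b - Polynomial.aeval ϖ (γ + Polynomial.C c * Polynomial.X ^ (L + 1)) =
        ϖ ^ (L + 1) * (d - algebraMap ℂ B c) + e := by
      simp only [map_add, map_mul, Polynomial.aeval_C, map_pow, Polynomial.aeval_X]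
      linear_combination -hde
    rw [this]
    exact add_mem (by rw [pow_succ 𝔭 (L + 1)]; exact Ideal.mul_mem_mul hmem hc) he

lemma X_pow_dvd_of_aeval_mem (hp : Prime 𝔭) {ϖ : B} (h1 : ϖ ∈ 𝔭) (h2 : ϖ ∉ 𝔭 ^ 2)
    {G : Polynomial ℂ} {M : ℕ} (h : Polynomial.aeval ϖ G ∈ 𝔭 ^ M) : Polynomial.X ^ M ∣ G := by
  have hϖ : emultiplicity 𝔭 (Ideal.span {ϖ}) ≤ 1 := by
    rw [mem_pow_iff_le_emultiplicity] at h2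
    exact Order.le_of_lt_add_one (by simpa [one_add_one_eq_two] using h2)
  induction M with
  | zero => simp
  | succ M ih =>
    obtain ⟨u, rfl⟩ := ih (Ideal.pow_le_pow_right M.le_succ h)
    rw [map_mul, map_pow, Polynomial.aeval_X, mem_pow_iff_le_emultiplicity,
      emultiplicity_span_mul hp, emultiplicity_span_pow hp] at h
    have hu : Polynomial.aeval ϖ u ∈ 𝔭 := by
      by_contra hu
      have h3 : emultiplicity 𝔭 (Ideal.span {Polynomial.aeval ϖ u}) < 1 := by
        rw [← not_le]
        intro h3
        exact hu (by rw [← pow_one 𝔭]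
                     exact (mem_pow_iff_le_emultiplicity (k := 1)).2 (by simpa using h3))
      rw [Order.lt_one_iff] at h3
      rw [h3, add_zero] at h
      have := h.trans (mul_le_mul_right hϖ _)
      rw [mul_one] at this
      norm_cast at this
      omega
    rw [pow_succ]
    refine mul_dvd_mul_left _ (Polynomial.X_dvd_iff.2 ?_)
    by_contra h0
    have h4 : algebraMap ℂ B (u.coeff 0) ∈ 𝔭 := by
      rw [← Polynomial.divX_mul_X_add u, map_add, map_mul, Polynomial.aeval_X,
        Polynomial.aeval_C] at hu
      exact (Ideal.add_mem_iff_right _ (Ideal.mul_mem_left _ _ h1)).1 hu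
    exact (Ideal.isPrime_of_prime hp).ne_top
      (Ideal.eq_top_of_isUnit_mem _ h4 ((Ne.isUnit h0).map _))

variable {σ : Type*}

/-- The hypothesis that along each polynomial curve of order `a` through the origin, some
member of `𝔎` vanishes to order at most `τ a`. -/
def CurveBound (𝔎 : Ideal (MvPolynomial σ ℂ)) (τ : ℝ) : Prop :=
  ∀ (γ : σ → Polynomial ℂ) (a : ℕ), (∀ i, (γ i).coeff 0 = 0) → (∃ i, (γ i).coeff a ≠ 0) →
    (∀ i, Polynomial.X ^ a ∣ γ i) → ∃ F ∈ 𝔎, ¬ Polynomial.X ^ (⌊τ * a⌋₊ + 1) ∣ aeval γ F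

lemma CurveBound.exists_notMem_pow {𝔎 : Ideal (MvPolynomial σ ℂ)} {τ : ℝ} (hτ : 0 ≤ τ)
    (h𝔎 : CurveBound 𝔎 τ) (hp : Prime 𝔭)
    (hres : ∀ b : B, ∃ c : ℂ, b - algebraMap ℂ B c ∈ 𝔭) {w : σ → B} (hw : ∀ i, w i ∈ 𝔭)
    {j : σ} (hj : w j ≠ 0) :
    ∃ a : ℕ, w j ∈ 𝔭 ^ a ∧ ∃ F ∈ 𝔎, aeval w F ∉ 𝔭 ^ (⌊τ * a⌋₊ + 1) := by
  classical
  obtain ⟨a, ha, ha'⟩ := exists_mem_pow_notMem_pow_succ hp hj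
  obtain ⟨ϖ, h1, h2⟩ : ∃ ϖ ∈ 𝔭, ϖ ∉ 𝔭 ^ 2 := by
    have hlt : 𝔭 ^ 2 < 𝔭 := by
      simpa using Ideal.pow_right_strictAnti 𝔭 hp.ne_zero (Ideal.isPrime_of_prime hp).ne_top
        one_lt_two
    exact SetLike.exists_of_lt hlt
  set L := a + ⌊τ * a⌋₊
  choose γ h0 hγ using fun i => exists_curve_approx hp hres h1 h2 (hw i) L
  have hle : ∀ k ≤ L + 1, ∀ i, w i - Polynomial.aeval ϖ (γ i) ∈ 𝔭 ^ k := fun k hk i =>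
    Ideal.pow_le_pow_right hk (hγ i)
  have hG : ∀ k ≤ L + 1, ∀ F : MvPolynomial σ ℂ, aeval w F ∈ 𝔭 ^ k →
      Polynomial.X ^ k ∣ aeval γ F := by
    intro k hk F hF
    refine X_pow_dvd_of_aeval_mem hp h1 h2 ?_
    rw [← Ideal.Quotient.eq_zero_iff_mem] at hF ⊢
    rw [← hF]
    have e1 : Polynomial.aeval ϖ (aeval γ F) = aeval (fun i => Polynomial.aeval ϖ (γ i)) F := by
      rw [← AlgHom.comp_apply, comp_aeval]
    rw [e1, ← Ideal.Quotient.mkₐ_eq_mk ℂ, ← AlgHom.comp_apply, ← AlgHom.comp_apply, comp_aeval,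
      comp_aeval]
    congr 2
    ext i
    exact (Ideal.Quotient.eq.2 (hle k hk i)).symm
  have hex : ∃ k, ∃ i, (γ i).coeff k ≠ 0 := by
    by_contra! hcon
    have : γ j = 0 := Polynomial.ext fun k => by simpa using hcon k j
    refine ha' ?_
    simpa [this] using hle (a + 1) (by omega) j
  have hνa : Nat.find hex ≤ a := by
    by_contra! hlt
    have hdvd : Polynomial.X ^ (a + 1) ∣ γ j := Polynomial.X_pow_dvd_iff.2 fun d hd => by
      by_contra hne
      exact Nat.find_min hex (by omega : d < Nat.find hex) ⟨j, hne⟩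
    obtain ⟨u, hu⟩ := hdvd
    have h3 := hle (a + 1) (by omega) j
    rw [hu, map_mul, map_pow, Polynomial.aeval_X] at h3
    exact ha' ((Submodule.sub_mem_iff_left _
      (Ideal.mul_mem_right _ _ (Ideal.pow_mem_pow h1 _))).1 h3)
  obtain ⟨F, hF, hnot⟩ := h𝔎 γ (Nat.find hex) h0 (Nat.find_spec hex) fun i =>
    Polynomial.X_pow_dvd_iff.2 fun d hd => by
      by_contra hne
      exact Nat.find_min hex hd ⟨i, hne⟩
  refine ⟨a, ha, F, hF, fun hmem => hnot ?_⟩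
  refine (pow_dvd_pow _ ?_).trans (hG _ (by omega) F hmem)
  gcongr

end Place



section Centers

open IsLocalRing

lemma aeval_injective_of_mem_maximalIdeal {R : Type*} [CommRing R] [IsDomain R] [IsLocalRing R]
    [Algebra ℂ R] {y : R} (hy : y ∈ maximalIdeal R) (hy0 : y ≠ 0) :
    Function.Injective (Polynomial.aeval (R := ℂ) y) := by
  rw [injective_iff_map_eq_zero]
  intro f hf
  by_contra hne
  obtain ⟨u, hu, hdvd⟩ := f.exists_eq_pow_rootMultiplicity_mul_and_not_dvd hne 0
  rw [map_zero, sub_zero] at hu hdvd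
  rw [hu, map_mul, map_pow, Polynomial.aeval_X] at hf
  rcases mul_eq_zero.1 hf with h | h
  · exact hy0 (eq_zero_of_pow_eq_zero h)
  · rw [Polynomial.X_dvd_iff] at hdvd
    rw [← Polynomial.divX_mul_X_add u, map_add, map_mul, Polynomial.aeval_X,
      Polynomial.aeval_C] at h
    have h4 : algebraMap ℂ R (u.coeff 0) ∈ maximalIdeal R := by
      rw [← (maximalIdeal R).add_mem_iff_right (Ideal.mul_mem_left _ _ hy), h]
      exact zero_mem _
    exact (mem_maximalIdeal _).1 h4 ((Ne.isUnit hdvd).map _)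

lemma isUnit_aeval_of_constantCoeff_ne_zero {R σ : Type*} [CommRing R] [IsLocalRing R]
    [Algebra ℂ R] {z : σ → R} (hz : ∀ i, z i ∈ maximalIdeal R) {H : MvPolynomial σ ℂ}
    (hH : constantCoeff H ≠ 0) : IsUnit (aeval z H) := by
  have e : (residue R).comp (aeval z : MvPolynomial σ ℂ →ₐ[ℂ] R).toRingHom =
      ((residue R).comp (algebraMap ℂ R)).comp constantCoeff := by
    refine MvPolynomial.ringHom_ext (fun c => by simp) (fun i => ?_)
    simpa using hz i
  rw [← IsLocalRing.notMem_maximalIdeal]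
  intro hmem
  have := congr_arg (fun f => f H) e
  simp only [RingHom.comp_apply, AlgHom.toRingHom_eq_coe, RingHom.coe_coe] at this
  rw [(residue_eq_zero_iff _).2 hmem] at this
  exact ((((Ne.isUnit hH).map (algebraMap ℂ R)).map (residue R)).ne_zero) this.symm

/-- Let `R` be a local domain obtained by localizing a quotient of a polynomial ring which is
integral over the polynomials in the `j`-th variable. The integrality of quotients `y ^ p / x ^ q`
over `R`, where `y` is the `j`-th variable, can be tested on finitely many valuations. -/
theorem CurveBound.exists_finite_centers {R K σ : Type*} [CommRing R] [IsDomain R]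
    [IsLocalRing R] [Algebra ℂ R] [Field K] [Algebra R K] [IsFractionRing R K] [Finite σ]
    {z : σ → R} (hz : ∀ i, z i ∈ maximalIdeal R)
    (hloc : ∀ r : R, ∃ G H : MvPolynomial σ ℂ, constantCoeff H ≠ 0 ∧ r * aeval z H = aeval z G)
    {j : σ} (hj : z j ≠ 0)
    (hint : ∀ i, (Polynomial.aeval (R := ℂ) (z j)).toRingHom.IsIntegralElem (z i))
    {𝔎 : Ideal (MvPolynomial σ ℂ)} {τ : ℝ} (hτ : 0 ≤ τ) (h𝔎 : CurveBound 𝔎 τ) :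
    ∃ S : Set (Ideal (MvPolynomial σ ℂ)), S.Finite ∧ (∀ 𝔮 ∈ S, ¬ 𝔎 ≤ 𝔮) ∧
      ∀ x : MvPolynomial σ ℂ, (∀ 𝔮 ∈ S, x ∉ 𝔮) → ∀ p q : ℕ, τ * q ≤ p →
        IsIntegral R (algebraMap R K (z j) ^ p / algebraMap R K (aeval z x) ^ q) := by
  classical
  let φ : Polynomial ℂ →+* K :=
    (algebraMap R K).comp (Polynomial.aeval (R := ℂ) (z j)).toRingHom
  have hφ : Function.Injective φ := (IsFractionRing.injective R K).comp
    (aeval_injective_of_mem_maximalIdeal (hz j) hj)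
  let _ : Algebra ℂ K := ((algebraMap R K).comp (algebraMap ℂ R)).toAlgebra
  let _ : Algebra (Polynomial ℂ) K := φ.toAlgebra
  have hφC : ∀ c : ℂ, φ (Polynomial.C c) = algebraMap ℂ K c := fun c => by
    simp [φ, RingHom.algebraMap_toAlgebra]
  have hφX : φ Polynomial.X = algebraMap R K (z j) := by simp [φ]
  have : IsScalarTower ℂ (Polynomial ℂ) K := .of_algebraMap_eq fun c => (hφC c).symm
  have : IsScalarTower ℂ R K := .of_algebraMap_eq fun c => rfl
  have : FaithfulSMul (Polynomial ℂ) K := (faithfulSMul_iff_algebraMap_injective _ _).2 hφ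
  let _ : Algebra (FractionRing (Polynomial ℂ)) K := FractionRing.liftAlgebra _ _
  have : IsScalarTower (Polynomial ℂ) (FractionRing (Polynomial ℂ)) K :=
    FractionRing.isScalarTower_liftAlgebra _ _
  let w' : σ → K := fun i => algebraMap R K (z i)
  have hw' : ∀ i, IsIntegral (Polynomial ℂ) (w' i) := fun i => by
    obtain ⟨f, hf, hf0⟩ := hint i
    refine ⟨f, hf, ?_⟩
    have := congr_arg (algebraMap R K) hf0
    rwa [Polynomial.hom_eval₂, map_zero] at this
  have haeval : ∀ G : MvPolynomial σ ℂ, algebraMap R K (aeval z G) = aeval w' G := fun G => by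
    rw [← aeval_algebraMap_apply]; rfl
  have hfd : FiniteDimensional (FractionRing (Polynomial ℂ)) K := by
    have htop : IntermediateField.adjoin (FractionRing (Polynomial ℂ)) (Set.range w') = ⊤ := by
      rw [eq_top_iff]
      have hpoly : ∀ G : MvPolynomial σ ℂ, aeval w' G ∈
          IntermediateField.adjoin (FractionRing (Polynomial ℂ)) (Set.range w') := by
        intro G
        induction G using MvPolynomial.induction_on with
        | C c =>
          rw [aeval_C, ← hφC, ← RingHom.algebraMap_toAlgebra φ,
            IsScalarTower.algebraMap_apply (Polynomial ℂ) (FractionRing (Polynomial ℂ)) K]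
          exact IntermediateField.algebraMap_mem _ _
        | add p q hp hq => rw [map_add]; exact add_mem hp hq
        | mul_X p i hp =>
          rw [map_mul, aeval_X]
          exact mul_mem hp (IntermediateField.subset_adjoin _ _ ⟨i, rfl⟩)
      have hR : ∀ r : R, algebraMap R K r ∈
          IntermediateField.adjoin (FractionRing (Polynomial ℂ)) (Set.range w') := by
        intro r
        obtain ⟨G, H, hH, h⟩ := hloc r
        have hH0 : algebraMap R K (aeval z H) ≠ 0 :=
          ((isUnit_aeval_of_constantCoeff_ne_zero hz hH).map (algebraMap R K)).ne_zero
        have h' := congr_arg (algebraMap R K) h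
        rw [map_mul, ← eq_div_iff hH0] at h'
        rw [h', haeval, haeval]
        exact div_mem (hpoly G) (hpoly H)
      rintro x -
      obtain ⟨a, b, -, rfl⟩ := IsFractionRing.div_surjective (A := R) x
      exact div_mem (hR a) (hR b)
    have := IntermediateField.finiteDimensional_adjoin (K := FractionRing (Polynomial ℂ))
      (S := Set.range w') (by
        rintro _ ⟨i, rfl⟩
        exact (hw' i).tower_top)
    rw [htop] at this
    exact IntermediateField.topEquiv.toLinearEquiv.finiteDimensional
  let B := integralClosure (Polynomial ℂ) K
  have hB : IsDedekindDomain B := inferInstance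
  let w : σ → B := fun i => ⟨w' i, hw' i⟩
  have hwj : w j ≠ 0 := fun h => hj <| by
    have : algebraMap R K (z j) = 0 := congr_arg (algebraMap B K) h
    rwa [FaithfulSMul.algebraMap_eq_zero_iff] at this
  have haevalB : ∀ G : MvPolynomial σ ℂ, ((aeval w G : B) : K) = algebraMap R K (aeval z G) := by
    intro G
    rw [haeval]
    change algebraMap B K (aeval w G) = _
    rw [← aeval_algebraMap_apply]
    rfl
  have hres : ∀ 𝔭 : Ideal B, 𝔭.IsPrime → (w j ∈ 𝔭) →
      ∀ b : B, ∃ c : ℂ, b - algebraMap ℂ B c ∈ 𝔭 := by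
    intro 𝔭 h𝔭 hj𝔭
    have : Algebra.IsIntegral ℂ (B ⧸ 𝔭) := by
      refine ⟨fun b => ?_⟩
      obtain ⟨b, rfl⟩ := Ideal.Quotient.mk_surjective b
      obtain ⟨f, hf, hf0⟩ := integralClosure.isIntegral (R := Polynomial ℂ) (A := K) b
      refine ⟨f.map (Polynomial.evalRingHom 0), hf.map _, ?_⟩
      rw [Polynomial.eval₂_map]
      have e : (algebraMap ℂ (B ⧸ 𝔭)).comp (Polynomial.evalRingHom 0) =
          (Ideal.Quotient.mk 𝔭).comp (algebraMap (Polynomial ℂ) B) := by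
        refine Polynomial.ringHom_ext (fun c => ?_) ?_
        · rw [RingHom.comp_apply, RingHom.comp_apply, Polynomial.coe_evalRingHom,
            Polynomial.eval_C]
          change Ideal.Quotient.mk 𝔭 (algebraMap ℂ B c) = _
          congr 1
          exact Subtype.ext (hφC c).symm
        · rw [RingHom.comp_apply, RingHom.comp_apply, Polynomial.coe_evalRingHom,
            Polynomial.eval_X, map_zero, eq_comm, Ideal.Quotient.eq_zero_iff_mem]
          convert! hj𝔭
          exact Subtype.ext hφX
      rw [e, ← Polynomial.hom_eval₂, hf0, map_zero]
    intro b
    obtain ⟨c, hc⟩ := (IsAlgClosed.algebraMap_bijective_of_isIntegral (k := ℂ)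
      (K := B ⧸ 𝔭)).2 (Ideal.Quotient.mk 𝔭 b)
    refine ⟨c, ?_⟩
    rw [← Ideal.Quotient.eq_zero_iff_mem, map_sub, ← hc, sub_eq_zero]
    rfl
  let T : Set (IsDedekindDomain.HeightOneSpectrum B) := {v | ∀ i, w i ∈ v.asIdeal}
  have hT : T.Finite := (Ideal.finite_factors (I := Ideal.span {w j}) (by simpa using hwj)).subset
    fun v hv => by simpa [Ideal.dvd_span_singleton] using hv j
  have hcurve : ∀ v : T, ∃ a : ℕ, w j ∈ v.1.asIdeal ^ a ∧
      ∃ F ∈ 𝔎, aeval w F ∉ v.1.asIdeal ^ (⌊τ * a⌋₊ + 1) := fun v =>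
    h𝔎.exists_notMem_pow hτ v.1.prime (hres _ v.1.isPrime (v.2 j)) v.2 hwj
  choose a ha F hF hFa using hcurve
  have := hT.to_subtype
  refine ⟨Set.range fun v : T => (v.1.asIdeal ^ (⌊τ * a v⌋₊ + 1)).comap (aeval w),
    Set.finite_range _, ?_, ?_⟩
  · rintro _ ⟨v, rfl⟩ hle
    exact hFa v (hle (hF v))
  intro x hx p q hpq
  by_contra hnot
  obtain ⟨V, hV, hVm, hxV⟩ := exists_valuationSubring_of_not_isIntegral hnot
  have hBV : ∀ b : B, (b : K) ∈ V := by
    rintro ⟨b, f, hf, hf0⟩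
    let φ' : Polynomial ℂ →+* V := φ.codRestrict V.toSubring fun g => hV _
    have : IsIntegral V b := ⟨f.map φ', hf.map _, by rw [Polynomial.eval₂_map]; exact hf0⟩
    obtain ⟨b', rfl⟩ := IsIntegrallyClosed.isIntegral_iff.1 this
    exact b'.2
  let ψ : B →+* V := (algebraMap B K).codRestrict V.toSubring hBV
  have hψ : ∀ i, w i ∈ (maximalIdeal V).comap ψ := fun i => by
    rw [Ideal.mem_comap, ← ValuationSubring.coe_mem_nonunits_iff]
    exact hVm _ (hz i)
  let v : IsDedekindDomain.HeightOneSpectrum B :=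
    ⟨(maximalIdeal V).comap ψ, inferInstance, fun h => hwj (by
      rw [← Ideal.mem_bot, ← h]; exact hψ j)⟩
  have hv : v ∈ T := hψ
  have hcV : ∀ c : B, c ∉ v.asIdeal → (c : K)⁻¹ ∈ V := fun c hc => by
    obtain ⟨u, hu⟩ := IsLocalRing.notMem_maximalIdeal.1 hc
    have h1 : ((u : V) : K) = c := by rw [hu]; rfl
    have h2 : ((u : V) : K) * ((u⁻¹ : Vˣ) : V) = 1 := by
      rw [← MulMemClass.coe_mul, Units.mul_inv, OneMemClass.coe_one]
    rw [← h1, ← eq_inv_of_mul_eq_one_right h2]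
    exact ((u⁻¹ : Vˣ) : V).2
  have hxv := hx _ ⟨⟨v, hv⟩, rfl⟩
  rw [Ideal.mem_comap] at hxv
  set k₀ := a ⟨v, hv⟩
  set ξ : B := aeval w x
  have hξ : ξ ≠ 0 := fun h => hxv (by rw [h]; exact zero_mem _)
  obtain ⟨k, hk, hk'⟩ := exists_mem_pow_notMem_pow_succ v.prime hξ
  have hkle : k ≤ ⌊τ * k₀⌋₊ := by
    by_contra! hlt
    exact hxv (Ideal.pow_le_pow_right hlt hk)
  obtain ⟨I, hI⟩ := Ideal.dvd_span_singleton.2 hk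
  have hIv : ¬ I ≤ v.asIdeal := by
    intro hle
    refine hk' (Ideal.dvd_span_singleton.1 ?_)
    rw [hI, pow_succ]
    exact mul_dvd_mul_left _ (Ideal.dvd_iff_le.2 hle)
  obtain ⟨c, hcI, hcv⟩ := SetLike.not_le_iff_exists.1 hIv
  have hle : q * k ≤ p * k₀ := by
    have h1 : (k : ℝ) ≤ τ * k₀ := (Nat.le_floor_iff (by positivity)).1 hkle
    have : (q : ℝ) * k ≤ p * k₀ := by
      nlinarith [mul_le_mul_of_nonneg_left h1 (Nat.cast_nonneg (α := ℝ) q),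
        mul_le_mul_of_nonneg_right hpq (Nat.cast_nonneg (α := ℝ) k₀)]
    exact_mod_cast this
  have hmem : w j ^ p * c ^ q ∈ Ideal.span {ξ ^ q} := by
    rw [← Ideal.span_singleton_pow, hI, mul_pow, ← pow_mul]
    refine Ideal.mul_mem_mul (Ideal.pow_le_pow_right (show k * q ≤ p * k₀ by rwa [mul_comm k q]) ?_)
      (Ideal.pow_mem_pow hcI q)
    rw [mul_comm p, pow_mul]
    exact Ideal.pow_mem_pow (ha _) p
  obtain ⟨b, hb⟩ := Ideal.mem_span_singleton.1 hmem
  have hb' := congr_arg (algebraMap B K) hb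
  simp only [map_mul, map_pow] at hb'
  have hξ0 : algebraMap B K ξ ≠ 0 := by rwa [Ne, FaithfulSMul.algebraMap_eq_zero_iff]
  have hc0 : algebraMap B K c ≠ 0 := by
    rw [Ne, FaithfulSMul.algebraMap_eq_zero_iff]
    rintro rfl
    exact hcv (zero_mem _)
  refine hxV ?_
  have h1 : algebraMap R K (z j) ^ p / algebraMap R K (aeval z x) ^ q =
      (b : K) * ((c : K)⁻¹) ^ q := by
    rw [← haevalB, inv_pow, ← div_eq_mul_inv]
    exact (div_eq_div_iff (pow_ne_zero _ hξ0) (pow_ne_zero _ hc0)).2 (hb'.trans (mul_comm _ _))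
  rw [h1]
  exact mul_mem (hBV b) (pow_mem (hcV c hcv) q)

end Centers

section Step
open IsLocalRing

lemma notMem_of_mem_minimalPrimes {A : Type*} [CommRing A] {P : Ideal A}
    (hP : P ∈ minimalPrimes A) {x : A} (hx : x ∈ nonZeroDivisors A) : x ∉ P := fun h =>
  Set.disjoint_left.1 (Ideal.disjoint_nonZeroDivisors_of_mem_minimalPrimes hP) h hx

theorem CurveBound.exists_length_le {A σ : Type*} [CommRing A] [IsNoetherianRing A]
    [IsLocalRing A] [Algebra ℂ A] [Finite σ] {z : σ → A} (hz : ∀ i, z i ∈ maximalIdeal A)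
    (hloc : ∀ r : A, ∃ G H : MvPolynomial σ ℂ, constantCoeff H ≠ 0 ∧ r * aeval z H = aeval z G)
    {j : σ} (hj : z j ∈ nonZeroDivisors A)
    (hint : ∀ i, (Polynomial.aeval (R := ℂ) (z j)).toRingHom.IsIntegralElem (z i))
    {𝔎 : Ideal (MvPolynomial σ ℂ)} {τ : ℝ} (hτ : 0 ≤ τ) (h𝔎 : CurveBound 𝔎 τ)
    {x : ℂ → MvPolynomial σ ℂ} (hx : ∀ c, aeval z (x c) ∈ nonZeroDivisors A)
    (hx𝔎 : ∀ 𝔮 : Ideal (MvPolynomial σ ℂ), ¬ 𝔎 ≤ 𝔮 → {c | x c ∈ 𝔮}.Finite)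
    {D : ℕ} (hD : Module.length ℂ (A ⧸ Ideal.span {z j}) = D) :
    ∃ (c : ℂ) (D' : ℕ), Module.length ℂ (A ⧸ Ideal.span {aeval z (x c)}) = D' ∧
      (D' : ℝ) ≤ τ * D := by
  have key : ∀ P : minimalPrimes A, ∃ S : Set (Ideal (MvPolynomial σ ℂ)), S.Finite ∧
      (∀ 𝔮 ∈ S, ¬ 𝔎 ≤ 𝔮) ∧ ∀ [P.1.IsPrime],
      ∀ f : MvPolynomial σ ℂ, (∀ 𝔮 ∈ S, f ∉ 𝔮) → ∀ p q : ℕ, τ * q ≤ p →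
        IsIntegral (A ⧸ P.1) (algebraMap (A ⧸ P.1) (FractionRing (A ⧸ P.1))
            (Ideal.Quotient.mk P.1 (z j ^ p)) /
          algebraMap (A ⧸ P.1) (FractionRing (A ⧸ P.1))
            (Ideal.Quotient.mk P.1 (aeval z f ^ q))) := by
    rintro ⟨P, hP⟩
    have hPp : P.IsPrime := hP.1.1
    have hloc' : IsLocalRing (A ⧸ P) := .of_surjective' _ Ideal.Quotient.mk_surjective
    have hev : ∀ G : MvPolynomial σ ℂ, aeval (fun i => Ideal.Quotient.mk P (z i)) G =
        Ideal.Quotient.mk P (aeval z G) := fun G => by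
      have := aeval_algebraMap_apply (A ⧸ P) z G
      exact this
    obtain ⟨S, hS, hS𝔎, hSx⟩ := h𝔎.exists_finite_centers (K := FractionRing (A ⧸ P))
      (z := fun i => Ideal.Quotient.mk P (z i)) (j := j)
      (fun i hu => by
        have := IsLocalHom.of_surjective (Ideal.Quotient.mk P) Ideal.Quotient.mk_surjective
        exact hz i (isUnit_of_map_unit (Ideal.Quotient.mk P) _ hu))
      (fun r => by
        obtain ⟨r, rfl⟩ := Ideal.Quotient.mk_surjective r
        obtain ⟨G, H, hH, h⟩ := hloc r
        exact ⟨G, H, hH, by rw [hev, hev, ← map_mul, h]⟩)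
      (fun h => notMem_of_mem_minimalPrimes hP hj (Ideal.Quotient.eq_zero_iff_mem.1 h))
      (fun i => by
        obtain ⟨f, hf, hf0⟩ := hint i
        refine ⟨f, hf, ?_⟩
        have : (Polynomial.aeval (R := ℂ) (Ideal.Quotient.mk P (z j))).toRingHom =
            (Ideal.Quotient.mk P).comp (Polynomial.aeval (R := ℂ) (z j)).toRingHom := by
          refine Polynomial.ringHom_ext (fun c => ?_) ?_
          · simp
          · simp
        rw [this, ← Polynomial.hom_eval₂, hf0, map_zero]) hτ
    refine ⟨S, hS, hS𝔎, fun f hf p q hpq => ?_⟩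
    have := hSx f hf p q hpq
    rwa [hev, ← map_pow, ← map_pow, ← map_pow, ← map_pow] at this
  choose S hS hS𝔎 hSx using key
  have hfin : (minimalPrimes A).Finite := minimalPrimes.finite_of_isNoetherianRing A
  have := hfin.to_subtype
  obtain ⟨c, hc⟩ := (Set.finite_iUnion fun P => (hS P).biUnion fun 𝔮 h𝔮 =>
    hx𝔎 𝔮 (hS𝔎 P 𝔮 h𝔮)).infinite_compl.nonempty
  simp only [Set.mem_compl_iff, Set.mem_iUnion, Set.mem_ofPred_eq, not_exists] at hc
  have hq : ∀ q : ℕ, 0 < q → ∃ D' : ℕ,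
      Module.length ℂ (A ⧸ Ideal.span {aeval z (x c)}) = D' ∧ q * D' ≤ ⌈τ * q⌉₊ * D := by
    intro q hq
    obtain ⟨N, hN⟩ := exists_pow_dvd_of_isIntegral (u := aeval z (x c) ^ q)
      (v := z j ^ ⌈τ * q⌉₊)
      (fun P hP => notMem_of_mem_minimalPrimes hP (pow_mem (hx c) q))
      (fun P _ hP => hSx ⟨P, hP⟩ _ (fun 𝔮 h𝔮 h => hc _ 𝔮 h𝔮 h) _ _ (Nat.le_ceil _))
    exact length_le_of_forall_dvd (hx c) hj hq hN hD
  obtain ⟨D', hD', -⟩ := hq 1 one_pos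
  refine ⟨c, D', hD', ?_⟩
  have hle : ∀ q : ℕ, 0 < q → (q : ℝ) * (D' - τ * D) ≤ D := by
    intro q h0
    obtain ⟨D'', h1, h2⟩ := hq q h0
    obtain rfl : D' = D'' := by exact_mod_cast hD'.symm.trans h1
    have h3 : (q : ℝ) * D' ≤ ⌈τ * q⌉₊ * D := by exact_mod_cast h2
    have h4 : (⌈τ * q⌉₊ : ℝ) ≤ τ * q + 1 := (Nat.ceil_lt_add_one (by positivity)).le
    have h5 := mul_le_mul_of_nonneg_right h4 (Nat.cast_nonneg (α := ℝ) D)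
    linarith
  by_contra! hlt
  obtain ⟨q, hq⟩ := exists_nat_gt ((D : ℝ) / (D' - τ * D))
  have hpos : (0 : ℝ) < D' - τ * D := by linarith
  rw [div_lt_iff₀ hpos] at hq
  have hq0 : 0 < q := by
    rcases Nat.eq_zero_or_pos q with rfl | h
    · have : (0 : ℝ) ≤ D := Nat.cast_nonneg D
      simp at hq; linarith
    · exact h
  linarith [hle q hq0]

end Step


section Multiplicity
open IsLocalRing

lemma finite_setOf_sum_pow_smul_mem {V : Type*} [AddCommGroup V] [Module ℂ V] {W : Submodule ℂ V}
    {N : ℕ} {w : ℕ → V} (hw : ∃ k < N, w k ∉ W) :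
    {c : ℂ | ∑ k ∈ Finset.range N, c ^ k • w k ∈ W}.Finite := by
  obtain ⟨k, hkN, hk⟩ := hw
  obtain ⟨φ, hφ⟩ : ∃ φ : Module.Dual ℂ (V ⧸ W), φ (W.mkQ (w k)) ≠ 0 := by
    by_contra! h
    exact hk ((Submodule.Quotient.mk_eq_zero W).1 ((Module.forall_dual_apply_eq_zero_iff ℂ _).1 h))
  by_contra hinf
  have h0 := Polynomial.eq_zero_of_infinite_isRoot
    (∑ k ∈ Finset.range N, Polynomial.monomial k (φ (W.mkQ (w k))))
    (Set.Infinite.mono (fun c hc => ?_) hinf)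
  · apply hφ
    have := congrArg (fun f => Polynomial.coeff f k) h0
    simpa [Polynomial.coeff_monomial, hkN] using this
  · have hc' : W.mkQ (∑ k ∈ Finset.range N, c ^ k • w k) = 0 :=
      (Submodule.Quotient.mk_eq_zero W).2 hc
    have := congrArg φ hc'
    simp only [map_sum, map_smul, map_zero] at this
    change Polynomial.IsRoot _ c
    rw [Polynomial.IsRoot, Polynomial.eval_finsetSum, ← this]
    refine Finset.sum_congr rfl fun k _ => ?_
    rw [Polynomial.eval_monomial, smul_eq_mul, mul_comm]

variable (σ : Type*)

/-- The maximal ideal of the origin. -/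
noncomputable abbrev originIdeal : Ideal (MvPolynomial σ ℂ) :=
  RingHom.ker (constantCoeff (R := ℂ) (σ := σ))

instance : (originIdeal σ).IsPrime := RingHom.ker_isPrime _

variable {σ}

section Localization

lemma mem_nonZeroDivisors_quotient {B : Type*} [CommRing B] {I : Ideal B} {b : B}
    (h : ∀ r, r * b ∈ I → r ∈ I) : Ideal.Quotient.mk I b ∈ nonZeroDivisors (B ⧸ I) := by
  refine mem_nonZeroDivisors_iff_right.2 fun r hr => ?_
  obtain ⟨r, rfl⟩ := Ideal.Quotient.mk_surjective r
  rw [← map_mul, Ideal.Quotient.eq_zero_iff_mem] at hr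
  exact Ideal.Quotient.eq_zero_iff_mem.2 (h r hr)

variable {O : Type*} [CommRing O] [Algebra (MvPolynomial σ ℂ) O]

lemma mem_nonZeroDivisors_of_forall [IsLocalization.AtPrime O (originIdeal σ)]
    {I : Ideal (MvPolynomial σ ℂ)} {f : MvPolynomial σ ℂ}
    (h : ∀ a, f * a ∈ I → a ∈ I) :
    Ideal.Quotient.mk (I.map (algebraMap _ (O)))
      (algebraMap _ (O) f) ∈ nonZeroDivisors
        (O ⧸ I.map (algebraMap _ (O))) := by
  refine mem_nonZeroDivisors_quotient fun r hr => ?_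
  obtain ⟨⟨G, H⟩, hG⟩ := IsLocalization.surj (originIdeal σ).primeCompl r
  have hu := IsLocalization.map_units (O) H
  refine (Ideal.mul_unit_mem_iff_mem _ hu).1 ?_
  have h1 := Ideal.mul_mem_right (algebraMap _ _ (H : MvPolynomial σ ℂ)) _ hr
  rw [mul_right_comm, hG, ← map_mul,
    IsLocalization.algebraMap_mem_map_algebraMap_iff (originIdeal σ).primeCompl] at h1
  rw [hG, IsLocalization.algebraMap_mem_map_algebraMap_iff (originIdeal σ).primeCompl]
  obtain ⟨m, hm, h2⟩ := h1
  exact ⟨m, hm, h _ (by convert h2 using 1; ring)⟩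

lemma mk_algebraMap_X_mem_maximalIdeal [IsLocalization.AtPrime O (originIdeal σ)]
    [IsLocalRing O] (I : Ideal O)
    [IsLocalRing (O ⧸ I)] (i : σ) :
    Ideal.Quotient.mk I (algebraMap (MvPolynomial σ ℂ) _ (X i)) ∈
      maximalIdeal (O ⧸ I) := by
  intro hu
  have : IsLocalHom (Ideal.Quotient.mk I) := .of_surjective _ Ideal.Quotient.mk_surjective
  have h1 := isUnit_of_map_unit (Ideal.Quotient.mk I) _ hu
  rw [IsLocalization.AtPrime.isUnit_to_map_iff _ (originIdeal σ)] at h1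
  exact h1 ((RingHom.mem_ker).2 (constantCoeff_X (R := ℂ) i))

variable [Algebra ℂ O] [IsScalarTower ℂ (MvPolynomial σ ℂ) O]

lemma aeval_mk_algebraMap_X (I : Ideal O) (G : MvPolynomial σ ℂ) :
    aeval (fun i => Ideal.Quotient.mk I (algebraMap (MvPolynomial σ ℂ) _ (X i))) G =
      Ideal.Quotient.mk I (algebraMap _ _ G) := by
  have h := aeval_algebraMap_apply (O ⧸ I)
    (fun i => algebraMap (MvPolynomial σ ℂ) (O) (X i)) G
  have h2 := aeval_algebraMap_apply (O) (X : σ → MvPolynomial σ ℂ) G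
  rw [aeval_X_left_apply] at h2
  exact h.trans (congrArg _ h2)

lemma isIntegralElem_mk_algebraMap_X [Fintype σ] {e : σ → ℕ} {g : σ → MvPolynomial σ ℂ}
    (hg : IsMonicSystem e g) {j : σ} (hgj : g j = X j) (i : σ) :
    (Polynomial.aeval (R := ℂ) (Ideal.Quotient.mk
      ((restIdeal g j).map (algebraMap _ (O)))
      (algebraMap (MvPolynomial σ ℂ) _ (X j)))).toRingHom.IsIntegralElem
      (Ideal.Quotient.mk ((restIdeal g j).map (algebraMap _ (O)))
        (algebraMap (MvPolynomial σ ℂ) _ (X i))) := by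
  obtain ⟨f, hf, hf0⟩ := (hg.finite_quotient j).to_isIntegral
    (Ideal.Quotient.mk (restIdeal g j) (X i))
  refine ⟨f, hf, ?_⟩
  let θ : MvPolynomial σ ℂ ⧸ restIdeal g j →+*
      O ⧸ (restIdeal g j).map (algebraMap _ (O)) :=
    Ideal.quotientMap _ (algebraMap _ _) Ideal.le_comap_map
  have : (Polynomial.aeval (R := ℂ) (Ideal.Quotient.mk
      ((restIdeal g j).map (algebraMap _ (O)))
      (algebraMap (MvPolynomial σ ℂ) _ (X j)))).toRingHom =
      θ.comp (Polynomial.aeval (R := ℂ) (Ideal.Quotient.mk (restIdeal g j) (g j))).toRingHom := by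
    refine Polynomial.ringHom_ext (fun c => ?_) ?_
    · simp only [AlgHom.toRingHom_eq_coe, RingHom.coe_coe, RingHom.comp_apply,
        Polynomial.aeval_C]
      exact congrArg (Ideal.Quotient.mk _) (IsScalarTower.algebraMap_apply ℂ (MvPolynomial σ ℂ) O c)
    · simp only [AlgHom.toRingHom_eq_coe, RingHom.coe_coe, RingHom.comp_apply,
        Polynomial.aeval_X, hgj]
      rfl
  rw [this]
  change Polynomial.eval₂ _ (θ (Ideal.Quotient.mk (restIdeal g j) (X i))) f = 0
  rw [← Polynomial.hom_eval₂, hf0, map_zero]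

variable [IsLocalization.AtPrime O (originIdeal σ)]

lemma exists_mul_aeval_eq (I : Ideal O) (r : O ⧸ I) :
    ∃ G H : MvPolynomial σ ℂ, constantCoeff H ≠ 0 ∧
      r * aeval (fun i => Ideal.Quotient.mk I (algebraMap (MvPolynomial σ ℂ) _ (X i))) H =
        aeval (fun i => Ideal.Quotient.mk I (algebraMap (MvPolynomial σ ℂ) _ (X i))) G := by
  obtain ⟨r, rfl⟩ := Ideal.Quotient.mk_surjective r
  obtain ⟨⟨G, H⟩, h⟩ := IsLocalization.surj (originIdeal σ).primeCompl r
  refine ⟨G, H, H.2, ?_⟩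
  rw [aeval_mk_algebraMap_X, aeval_mk_algebraMap_X, ← map_mul, h]

lemma CurveBound.exists_length_quotient_le [Finite σ] {𝔞 𝔎 : Ideal (MvPolynomial σ ℂ)}
    (h𝔞 : 𝔞 ≤ originIdeal σ) {j : σ} {τ : ℝ} (hτ : 0 ≤ τ) (h𝔎 : CurveBound 𝔎 τ)
    (hint : ∀ i, (Polynomial.aeval (R := ℂ)
      (Ideal.Quotient.mk (𝔞.map (algebraMap (MvPolynomial σ ℂ) O))
      (algebraMap (MvPolynomial σ ℂ) _ (X j)))).toRingHom.IsIntegralElem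
      (Ideal.Quotient.mk (𝔞.map (algebraMap (MvPolynomial σ ℂ) O))
        (algebraMap (MvPolynomial σ ℂ) _ (X i))))
    (hj : ∀ a, X j * a ∈ 𝔞 → a ∈ 𝔞) {x : ℂ → MvPolynomial σ ℂ}
    (hx : ∀ c a, x c * a ∈ 𝔞 → a ∈ 𝔞)
    (hx𝔎 : ∀ 𝔮 : Ideal (MvPolynomial σ ℂ), ¬ 𝔎 ≤ 𝔮 → {c | x c ∈ 𝔮}.Finite)
    {D : ℕ} (hD : Module.length ℂ ((O ⧸ 𝔞.map (algebraMap (MvPolynomial σ ℂ) O)) ⧸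
        Ideal.span {Ideal.Quotient.mk (𝔞.map (algebraMap (MvPolynomial σ ℂ) O))
          (algebraMap (MvPolynomial σ ℂ) O (X j))}) = D) :
    ∃ (c : ℂ) (D' : ℕ), Module.length ℂ ((O ⧸ 𝔞.map (algebraMap (MvPolynomial σ ℂ) O)) ⧸
        Ideal.span {Ideal.Quotient.mk (𝔞.map (algebraMap (MvPolynomial σ ℂ) O))
          (algebraMap (MvPolynomial σ ℂ) O (x c))}) = D' ∧
      (D' : ℝ) ≤ τ * D := by
  have hlocO : IsLocalRing O := IsLocalization.AtPrime.isLocalRing O (originIdeal σ)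
  have hIle : 𝔞.map (algebraMap _ O) ≤ maximalIdeal O := by
    rw [← IsLocalization.AtPrime.map_eq_maximalIdeal (originIdeal σ) O]
    exact Ideal.map_mono h𝔞
  have hIne : 𝔞.map (algebraMap _ O) ≠ ⊤ := fun h =>
    (maximalIdeal.isMaximal _).ne_top (top_le_iff.1 (h.symm.trans_le hIle))
  have hnt := Ideal.Quotient.nontrivial_iff.2 hIne
  have hlocA : IsLocalRing (O ⧸ 𝔞.map (algebraMap _ O)) :=
    .of_surjective' _ Ideal.Quotient.mk_surjective
  have hnoeth : IsNoetherianRing O :=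
    IsLocalization.isNoetherianRing (originIdeal σ).primeCompl _ inferInstance
  obtain ⟨c, D', h1, h2⟩ := h𝔎.exists_length_le (mk_algebraMap_X_mem_maximalIdeal _)
    (exists_mul_aeval_eq (σ := σ) _) (mem_nonZeroDivisors_of_forall hj) hint hτ
    (fun c => by
      rw [aeval_mk_algebraMap_X]
      exact mem_nonZeroDivisors_of_forall (hx c)) hx𝔎 hD
  refine ⟨c, D', ?_, h2⟩
  rw [← h1, aeval_mk_algebraMap_X]

end Localization

variable (σ) in
/-- The local ring of affine space at the origin. -/
abbrev OriginLocalRing : Type _ := Localization.AtPrime (originIdeal σ)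

/-- The length of the local ring at the origin of the scheme defined by an ideal. -/
noncomputable def originLength (J : Ideal (MvPolynomial σ ℂ)) : ℕ∞ :=
  Module.length ℂ (OriginLocalRing σ ⧸ J.map (algebraMap _ (OriginLocalRing σ)))

lemma originLength_anti {I J : Ideal (MvPolynomial σ ℂ)} (h : I ≤ J) :
    originLength J ≤ originLength I :=
  length_quotient_le_of_le (Ideal.map_mono h)

lemma originLength_sup_span (I : Ideal (MvPolynomial σ ℂ)) (f : MvPolynomial σ ℂ) :
    originLength (I ⊔ Ideal.span {f}) =
      Module.length ℂ ((OriginLocalRing σ ⧸ I.map (algebraMap _ (OriginLocalRing σ))) ⧸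
        Ideal.span {Ideal.Quotient.mk (I.map (algebraMap _ (OriginLocalRing σ)))
          (algebraMap _ (OriginLocalRing σ) f)}) := by
  rw [originLength, Ideal.map_sup,
    ← (DoubleQuot.quotQuotEquivQuotSupₐ ℂ _ _).toLinearEquiv.length_eq,
    Ideal.map_span, Set.image_singleton]
  have := Ideal.map_span (Ideal.Quotient.mkₐ ℂ (I.map (algebraMap _ (OriginLocalRing σ))))
    {algebraMap _ (OriginLocalRing σ) f}
  rw [Set.image_singleton] at this
  rw [this]
  rfl

lemma originLength_span_X :
    originLength (Ideal.span (Set.range (X : σ → MvPolynomial σ ℂ))) ≤ 1 := by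
  set I := (Ideal.span (Set.range (X : σ → MvPolynomial σ ℂ))).map
    (algebraMap _ (OriginLocalRing σ)) with hI
  have hz : (fun i => Ideal.Quotient.mk I (algebraMap (MvPolynomial σ ℂ) _ (X i))) = 0 := by
    funext i
    exact Ideal.Quotient.eq_zero_iff_mem.2
      (Ideal.mem_map_of_mem _ (Ideal.subset_span ⟨i, rfl⟩))
  have hsurj : Function.Surjective (Algebra.linearMap ℂ (OriginLocalRing σ ⧸ I)) := by
    intro r
    obtain ⟨G, H, hH, h⟩ := exists_mul_aeval_eq (σ := σ) I r
    rw [hz, aeval_zero, aeval_zero] at h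
    refine ⟨constantCoeff G / constantCoeff H, ?_⟩
    rw [Algebra.linearMap_apply, div_eq_mul_inv, map_mul, ← h, mul_assoc, ← map_mul,
      mul_inv_cancel₀ hH, map_one, mul_one]
  exact (Module.length_le_of_surjective _ hsurj).trans_eq (Module.length_eq_one ℂ ℂ)

lemma sub_C_constantCoeff_mem (f : MvPolynomial σ ℂ) :
    f - C (constantCoeff f) ∈ Ideal.span (Set.range (X : σ → MvPolynomial σ ℂ)) := by
  rw [← Set.image_univ, mem_ideal_span_X_image]
  intro ρ hρ
  have : ρ ≠ 0 := by
    rintro rfl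
    simp [constantCoeff_eq] at hρ
  obtain ⟨i, hi⟩ := Finsupp.ne_iff.1 this
  exact ⟨i, trivial, hi⟩

lemma finrank_quotient_le_originLength [Finite σ] {J : Ideal (MvPolynomial σ ℂ)} {K : ℕ}
    (hK : ∀ i, X i ^ K ∈ J) {D : ℕ} (hD : originLength J ≤ D) :
    Module.finrank ℂ (MvPolynomial σ ℂ ⧸ J) ≤ D := by
  let φ : (MvPolynomial σ ℂ ⧸ J) →ₗ[ℂ]
      OriginLocalRing σ ⧸ J.map (algebraMap _ (OriginLocalRing σ)) :=
    (Ideal.quotientMapₐ (J.map (algebraMap _ (OriginLocalRing σ)))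
      (IsScalarTower.toAlgHom ℂ (MvPolynomial σ ℂ) (OriginLocalRing σ))
      Ideal.le_comap_map).toLinearMap
  have hφ : Function.Injective φ := by
    rw [injective_iff_map_eq_zero]
    intro a ha
    obtain ⟨a, rfl⟩ := Ideal.Quotient.mk_surjective a
    have h1 : algebraMap _ (OriginLocalRing σ) a ∈ J.map (algebraMap _ (OriginLocalRing σ)) :=
      Ideal.Quotient.eq_zero_iff_mem.1 ha
    rw [IsLocalization.algebraMap_mem_map_algebraMap_iff (originIdeal σ).primeCompl] at h1
    obtain ⟨m, hm, h⟩ := h1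
    have hu : IsUnit (Ideal.Quotient.mk J m) := by
      have hnil : IsNilpotent (Ideal.Quotient.mk J (m - C (constantCoeff m))) := by
        have hle : Ideal.span (Set.range (X : σ → MvPolynomial σ ℂ)) ≤ J.radical := by
          rw [Ideal.span_le]
          rintro _ ⟨i, rfl⟩
          exact ⟨K, hK i⟩
        obtain ⟨k, hk⟩ := hle (sub_C_constantCoeff_mem m)
        exact ⟨k, by rw [← map_pow]; exact Ideal.Quotient.eq_zero_iff_mem.2 hk⟩
      have hC : IsUnit (Ideal.Quotient.mk J (C (constantCoeff m))) :=
        ((isUnit_iff_ne_zero.2 hm).map C).map _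
      have := hnil.isUnit_add_left_of_commute hC (Commute.all _ _)
      rwa [← map_add, add_sub_cancel] at this
    have h2 : Ideal.Quotient.mk J m * Ideal.Quotient.mk J a = 0 := by
      rw [← map_mul]; exact Ideal.Quotient.eq_zero_iff_mem.2 h
    exact (hu.mul_right_eq_zero).1 h2
  have hle := (Module.length_le_of_injective φ hφ).trans hD
  have hfin : Module.Finite ℂ (MvPolynomial σ ℂ ⧸ J) := by
    have := Module.length_ne_top_iff.1 (hle.trans_lt (ENat.natCast_lt_top D)).ne
    have := (isFiniteLength_iff_isNoetherian_isArtinian.1 this).1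
    infer_instance
  rw [Module.length_eq_finrank] at hle
  exact_mod_cast hle

lemma CurveBound.exists_originLength_sup [Finite σ] {𝔞 𝔎 : Ideal (MvPolynomial σ ℂ)}
    (h𝔞 : 𝔞 ≤ originIdeal σ) {j : σ} {τ : ℝ} (hτ : 0 ≤ τ) (h𝔎 : CurveBound 𝔎 τ)
    (hint : ∀ i, (Polynomial.aeval (R := ℂ) (Ideal.Quotient.mk
      (𝔞.map (algebraMap _ (OriginLocalRing σ)))
      (algebraMap (MvPolynomial σ ℂ) _ (X j)))).toRingHom.IsIntegralElem
      (Ideal.Quotient.mk (𝔞.map (algebraMap _ (OriginLocalRing σ)))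
        (algebraMap (MvPolynomial σ ℂ) _ (X i))))
    (hj : ∀ a, X j * a ∈ 𝔞 → a ∈ 𝔞) {x : ℂ → MvPolynomial σ ℂ}
    (hx : ∀ c a, x c * a ∈ 𝔞 → a ∈ 𝔞)
    (hx𝔎 : ∀ 𝔮 : Ideal (MvPolynomial σ ℂ), ¬ 𝔎 ≤ 𝔮 → {c | x c ∈ 𝔮}.Finite)
    {D : ℕ} (hD : originLength (𝔞 ⊔ Ideal.span {X j}) = D) :
    ∃ (c : ℂ) (D' : ℕ), originLength (𝔞 ⊔ Ideal.span {x c}) = D' ∧ (D' : ℝ) ≤ τ * D := by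
  rw [originLength_sup_span] at hD
  obtain ⟨c, D', h1, h2⟩ := h𝔎.exists_length_quotient_le h𝔞 hτ hint hj hx hx𝔎 hD
  exact ⟨c, D', (originLength_sup_span _ _).trans h1, h2⟩

lemma span_range_update [DecidableEq σ] (g : σ → MvPolynomial σ ℂ) (j : σ)
    (f : MvPolynomial σ ℂ) :
    Ideal.span (Set.range (Function.update g j f)) = restIdeal g j ⊔ Ideal.span {f} := by
  rw [restIdeal, ← Ideal.span_union]
  congr 1
  ext y
  constructor
  · rintro ⟨i, rfl⟩
    by_cases hi : i = j
    · subst hi; right; simp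
    · left; exact ⟨⟨i, hi⟩, by simp [hi]⟩
  · rintro (⟨⟨i, hi⟩, rfl⟩ | rfl)
    · exact ⟨i, by simp [hi]⟩
    · exact ⟨j, by simp⟩

lemma IsMonicSystem.update [DecidableEq σ] {e : σ → ℕ} {g : σ → MvPolynomial σ ℂ}
    (hg : IsMonicSystem e g) {j : σ} {K : ℕ} (hK : 0 < K) {f : MvPolynomial σ ℂ}
    (hf : f - X j ^ K ∈ degLT σ K) :
    IsMonicSystem (Function.update e j K) (Function.update g j f) := by
  intro i
  by_cases hi : i = j
  · subst hi; simpa using ⟨hK, hf⟩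
  · simpa [hi] using hg i

lemma CurveBound.exists_originLength_update [Fintype σ] [DecidableEq σ] {e : σ → ℕ}
    {g : σ → MvPolynomial σ ℂ} (hg : IsMonicSystem e g) (hg0 : ∀ i, constantCoeff (g i) = 0)
    {j : σ} (hgj : g j = X j) {K : ℕ} (hK : 0 < K) {𝔎 : Ideal (MvPolynomial σ ℂ)} {τ : ℝ}
    (hτ : 0 ≤ τ) (h𝔎 : CurveBound 𝔎 τ) {x : ℂ → MvPolynomial σ ℂ}
    (hx : ∀ c, x c - X j ^ K ∈ degLT σ K)
    (hx𝔎 : ∀ 𝔮 : Ideal (MvPolynomial σ ℂ), ¬ 𝔎 ≤ 𝔮 → {c | x c ∈ 𝔮}.Finite)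
    {D : ℕ} (hD : originLength (Ideal.span (Set.range g)) = D) :
    ∃ (c : ℂ) (D' : ℕ), originLength (Ideal.span (Set.range (Function.update g j (x c)))) = D' ∧
      (D' : ℝ) ≤ τ * D := by
  have hle : restIdeal g j ≤ originIdeal σ := by
    rw [restIdeal, Ideal.span_le]
    rintro _ ⟨i, rfl⟩
    exact (RingHom.mem_ker).2 (hg0 i)
  simp only [span_range_update]
  refine h𝔎.exists_originLength_sup hle hτ (isIntegralElem_mk_algebraMap_X hg hgj)
    (fun a ha => hg.mem_of_mul_mem j (by rwa [hgj])) (fun c a ha => ?_) hx𝔎 ?_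
  · have hrest : restIdeal (Function.update g j (x c)) j = restIdeal g j := by
      rw [restIdeal, restIdeal]
      congr 2
      funext i
      simp [i.2]
    rw [← hrest] at ha ⊢
    exact (hg.update hK (hx c)).mem_of_mul_mem j (by simpa using ha)
  · rw [← hD, ← span_range_update, ← hgj, Function.update_eq_self]

/-- A bound for the colength of an ideal in terms of its contact with polynomial curves. -/
theorem CurveBound.finrank_quotient_le [Fintype σ] {𝔎 : Ideal (MvPolynomial σ ℂ)} {τ : ℝ}
    (hτ : 0 ≤ τ) (h𝔎 : CurveBound 𝔎 τ) {K : ℕ} (hK : ∀ i, X i ^ K ∈ 𝔎) :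
    (Module.finrank ℂ (MvPolynomial σ ℂ ⧸ 𝔎) : ℝ) ≤ τ ^ Fintype.card σ := by
  classical
  by_cases htop : 𝔎 = ⊤
  · subst htop
    have : Subsingleton (MvPolynomial σ ℂ ⧸ (⊤ : Ideal (MvPolynomial σ ℂ))) :=
      Ideal.Quotient.subsingleton_iff.2 rfl
    rw [Module.finrank_zero_of_subsingleton]
    simpa using pow_nonneg hτ _
  have h𝔎0 : ∀ f ∈ 𝔎, constantCoeff f = 0 := by
    intro f hf
    obtain ⟨𝔫, h𝔫, hle⟩ := Ideal.exists_le_maximal 𝔎 htop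
    have hX : Ideal.span (Set.range (X : σ → MvPolynomial σ ℂ)) ≤ 𝔫 := by
      rw [Ideal.span_le]
      rintro _ ⟨i, rfl⟩
      exact h𝔫.isPrime.mem_of_pow_mem _ (hle (hK i))
    have h1 := Ideal.sub_mem _ (hle hf) (hX (sub_C_constantCoeff_mem f))
    rw [sub_sub_cancel] at h1
    by_contra h0
    exact h𝔫.ne_top (Ideal.eq_top_of_isUnit_mem _ h1 ((isUnit_iff_ne_zero.2 h0).map C))
  obtain ⟨N, F, hF⟩ := Submodule.fg_iff_exists_fin_generating_family.1
    (IsNoetherian.noetherian 𝔎)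
  have hF𝔎 : ∀ k, F k ∈ 𝔎 := fun k => hF ▸ Ideal.subset_span ⟨k, rfl⟩
  choose d hd using fun k => exists_mem_degLT (F k)
  obtain ⟨L, hL0, hLK, hLd⟩ : ∃ L, 0 < L ∧ K ≤ L ∧ ∀ k, d k ≤ L :=
    ⟨K + 1 + ∑ k, d k, by omega, by omega, fun k =>
      (Finset.single_le_sum (fun _ _ => Nat.zero_le _) (Finset.mem_univ k)).trans
        (Nat.le_add_left _ _)⟩
  have hL : ∀ i, X i ^ L ∈ 𝔎 := fun i => 𝔎.pow_mem_of_pow_mem (hK i) hLK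
  let w : σ → ℕ → MvPolynomial σ ℂ := fun i k =>
    if k = 0 then X i ^ L else if h : k - 1 < N then F ⟨k - 1, h⟩ else 0
  let x : σ → ℂ → MvPolynomial σ ℂ := fun i c => ∑ k ∈ Finset.range (N + 1), c ^ k • w i k
  have hw𝔎 : ∀ i k, w i k ∈ 𝔎 := by
    intro i k
    simp only [w]
    split_ifs
    exacts [hL i, hF𝔎 _, zero_mem _]
  have hx𝔎 : ∀ i c, x i c ∈ 𝔎 := fun i c => sum_mem fun k _ =>
    Submodule.smul_of_tower_mem _ _ (hw𝔎 i k)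
  have hxdeg : ∀ i c, x i c - X i ^ L ∈ degLT σ L := by
    intro i c
    simp only [x]
    rw [Finset.sum_range_succ', pow_zero, one_smul]
    simp only [w, if_pos, add_sub_cancel_right]
    refine Submodule.sum_mem _ fun k _ => Submodule.smul_mem _ _ ?_
    rw [if_neg k.succ_ne_zero]
    split_ifs
    exacts [degLT_mono (hLd _) (hd _), zero_mem _]
  have hxfin : ∀ i (𝔮 : Ideal (MvPolynomial σ ℂ)), ¬ 𝔎 ≤ 𝔮 → {c | x i c ∈ 𝔮}.Finite := by
    intro i 𝔮 h𝔮
    refine finite_setOf_sum_pow_smul_mem (W := 𝔮.restrictScalars ℂ) ?_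
    by_contra! h
    refine h𝔮 ?_
    rw [← hF]
    refine Submodule.span_le.2 ?_
    rintro _ ⟨k, rfl⟩
    simpa [w] using h (k + 1) (by simp)
  have key : ∀ s : Finset σ, ∃ (g : σ → MvPolynomial σ ℂ) (e : σ → ℕ) (D : ℕ),
      IsMonicSystem e g ∧ (∀ i ∈ s, g i ∈ 𝔎) ∧ (∀ i ∉ s, g i = X i) ∧
      originLength (Ideal.span (Set.range g)) = D ∧ (D : ℝ) ≤ τ ^ s.card := by
    intro s
    induction s using Finset.induction_on with
    | empty =>
      have h1 := originLength_span_X (σ := σ)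
      obtain ⟨D, hD⟩ := ENat.ne_top_iff_exists.1 (h1.trans_lt (ENat.natCast_lt_top 1)).ne
      refine ⟨X, fun _ => 1, D, fun i => ⟨one_pos, by simp⟩, by simp, by simp, hD.symm, ?_⟩
      rw [← hD] at h1
      simpa using (by exact_mod_cast h1 : D ≤ 1)
    | insert j s hj ih =>
      obtain ⟨g, e, D, hg, hgs, hgX, hgD, hDτ⟩ := ih
      have hg0 : ∀ i, constantCoeff (g i) = 0 := fun i => by
        by_cases hi : i ∈ s
        · exact h𝔎0 _ (hgs i hi)
        · rw [hgX i hi, constantCoeff_X]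
      obtain ⟨c, D', h1, h2⟩ := h𝔎.exists_originLength_update hg hg0 (hgX j hj) hL0 hτ
        (hxdeg j) (hxfin j) hgD
      refine ⟨Function.update g j (x j c), Function.update e j L, D', ?_, ?_, ?_, h1, ?_⟩
      · exact hg.update hL0 (hxdeg j c)
      · intro i hi
        by_cases hij : i = j
        · subst hij; simpa using hx𝔎 i c
        · simpa [hij] using hgs i (by simpa [hij] using hi)
      · intro i hi
        rw [Finset.mem_insert, not_or] at hi
        simpa [hi.1] using hgX i hi.2
      · rw [Finset.card_insert_of_notMem hj, pow_succ']
        exact h2.trans (mul_le_mul_of_nonneg_left hDτ hτ)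
  obtain ⟨g, e, D, -, hg, -, hD, hDτ⟩ := key Finset.univ
  have hle : originLength 𝔎 ≤ D := hD ▸ originLength_anti (Ideal.span_le.2 (by
    rintro _ ⟨i, rfl⟩; exact hg i (Finset.mem_univ i)))
  have := finrank_quotient_le_originLength hK hle
  exact le_trans (by exact_mod_cast this) hDτ

end Multiplicity

end PolynomialIdeals

section Taylor
open Filter Asymptotics

variable {E F : Type*} [NormedAddCommGroup E] [NormedSpace ℝ E] [NormedAddCommGroup F]
  [NormedSpace ℝ F]

lemma ContDiffAt.iteratedFDeriv_comp_swap (j : ℕ) : ∀ (i : Fin j) {f : E → F} {x : E},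
    ContDiffAt ℝ (j + 1 : ℕ) f x → ∀ v : Fin (j + 1) → E,
    iteratedFDeriv ℝ (j + 1) f x (v ∘ Equiv.swap i.castSucc i.succ) =
      iteratedFDeriv ℝ (j + 1) f x v := by
  induction j with
  | zero => exact fun i => i.elim0
  | succ j ih =>
    intro i f x hf v
    induction i using Fin.cases with
    | zero =>
      have key : ∀ w : Fin (j + 2) → E, iteratedFDeriv ℝ (j + 2) f x w =
          fderiv ℝ (fderiv ℝ (iteratedFDeriv ℝ j f)) x (w 0) (w 1) (Fin.tail (Fin.tail w)) := by
        intro w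
        have hd : DifferentiableAt ℝ (iteratedFDeriv ℝ (j + 1) f) x :=
          hf.differentiableAt_iteratedFDeriv (by norm_cast; omega)
        have hd' : DifferentiableAt ℝ (fderiv ℝ (iteratedFDeriv ℝ j f)) x := by
          refine ((hf.iteratedFDeriv_right (m := 2) ?_).fderiv_right (m := 1) ?_).differentiableAt
            (by simp)
          · norm_cast; omega
          · norm_num
        rw [iteratedFDeriv_succ_apply_left, ← fderiv_continuousMultilinear_apply_const_apply hd]
        simp only [iteratedFDeriv_succ_apply_left]
        rw [fderiv_continuousMultilinear_apply_const_apply (by fun_prop),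
          fderiv_clm_apply hd' (by fun_prop)]
        simp [Fin.tail]
      have hsymm : IsSymmSndFDerivAt ℝ (iteratedFDeriv ℝ j f) x := by
        refine ContDiffAt.isSymmSndFDerivAt (n := 2) ?_ (by simp)
        refine hf.iteratedFDeriv_right ?_
        norm_cast
        omega
      rw [key, key, hsymm]
      congr 2
    | succ i =>
      have hd : DifferentiableAt ℝ (iteratedFDeriv ℝ (j + 1) f) x :=
        hf.differentiableAt_iteratedFDeriv (by norm_cast; omega)
      have key : ∀ w : Fin (j + 2) → E, iteratedFDeriv ℝ (j + 2) f x w =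
          fderiv ℝ (fun y => iteratedFDeriv ℝ (j + 1) f y (Fin.tail w)) x (w 0) := by
        intro w
        rw [iteratedFDeriv_succ_apply_left, fderiv_continuousMultilinear_apply_const_apply hd]
      have hev : (fun y => iteratedFDeriv ℝ (j + 1) f y
          (Fin.tail (v ∘ Equiv.swap i.succ.castSucc i.succ.succ))) =ᶠ[𝓝 x]
          fun y => iteratedFDeriv ℝ (j + 1) f y (Fin.tail v) := by
        filter_upwards [hf.eventually (by simp)] with y hy
        rw [← ih i (hy.of_le (by norm_cast; omega)) (Fin.tail v)]
        congr 1
        ext k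
        simp only [Fin.tail, Function.comp]
        congr 1
        rw [← Fin.succ_castSucc, (Fin.succ_injective _).swap_apply]
      rw [key, key, hev.fderiv_eq]
      congr 2

lemma ContDiffAt.iteratedFDeriv_comp_perm_of_nat {j : ℕ} {f : E → F} {x : E}
    (hf : ContDiffAt ℝ j f x) (e : Equiv.Perm (Fin j)) (v : Fin j → E) :
    iteratedFDeriv ℝ j f x (v ∘ e) = iteratedFDeriv ℝ j f x v := by
  cases j with
  | zero => congr 1; ext i; exact i.elim0
  | succ j =>
    have he : e ∈ Submonoid.closure (Set.range fun i : Fin j ↦ Equiv.swap i.castSucc i.succ) := by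
      rw [Equiv.Perm.mclosure_swap_castSucc_succ]; trivial
    induction he using Submonoid.closure_induction generalizing v with
    | mem e he => obtain ⟨i, rfl⟩ := he; exact hf.iteratedFDeriv_comp_swap j i v
    | one => rfl
    | mul e e' _ _ h h' => rw [Equiv.Perm.coe_mul, ← Function.comp_assoc, h', h]

lemma ContDiffAt.iteratedFDeriv_eq_zero_of_diagonal {j : ℕ} {f : E → F} {x : E}
    (hf : ContDiffAt ℝ j f x) (h : ∀ y, iteratedFDeriv ℝ j f x (fun _ => y) = 0) :
    iteratedFDeriv ℝ j f x = 0 := by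
  ext v
  have h1 := ContinuousMultilinearMap.iteratedFDeriv_comp_diagonal (iteratedFDeriv ℝ j f x) 0 v
  have h2 : (fun y => iteratedFDeriv ℝ j f x (fun _ => y)) = fun _ => 0 := funext h
  have h4 : ∀ e : Equiv.Perm (Fin j), (iteratedFDeriv ℝ j f x fun i => v (e i)) =
    iteratedFDeriv ℝ j f x v := fun e => hf.iteratedFDeriv_comp_perm_of_nat e v
  rw [h2, Finset.sum_congr rfl fun e _ => h4 e] at h1
  simp only [Finset.sum_const, Finset.card_univ, Fintype.card_perm, Fintype.card_fin] at h1
  have h3 : iteratedFDeriv ℝ j (fun _ : E => (0 : F)) 0 v = 0 := by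
    rw [iteratedFDeriv_fun_zero]; rfl
  rw [h3, ← Nat.cast_smul_eq_nsmul ℝ] at h1
  have := (smul_eq_zero.1 h1.symm).resolve_left (by exact_mod_cast j.factorial_ne_zero)
  simpa using this

lemma taylor_isBigO [CompleteSpace F] {f : E → F} {x : E} (hf : ContDiffAt ℝ (⊤ : ℕ∞) f x) (m : ℕ) :
    (fun y => f (x + y) - ∑ k ∈ Finset.range (m + 1),
      ((k.factorial : ℝ))⁻¹ • iteratedFDeriv ℝ k f x (fun _ => y)) =O[𝓝 0]
      fun y => ‖y‖ ^ (m + 1) := by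
  have h1 : ∀ᶠ y in 𝓝 x, ContDiffAt ℝ (m + 1 : ℕ) f y :=
    (hf.of_le (by exact_mod_cast le_top)).eventually (by simp)
  have h2 : ContinuousAt (iteratedFDeriv ℝ (m + 1) f) x :=
    (hf.differentiableAt_iteratedFDeriv (by exact_mod_cast ENat.natCast_lt_top _)).continuousAt
  have h3 : ∀ᶠ y in 𝓝 x, ‖iteratedFDeriv ℝ (m + 1) f y‖ < ‖iteratedFDeriv ℝ (m + 1) f x‖ + 1 :=
    h2.norm.eventually_lt_const (by linarith)
  obtain ⟨ε, hε, hb⟩ := Metric.eventually_nhds_iff_ball.1 (h1.and h3)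
  set C := ‖iteratedFDeriv ℝ (m + 1) f x‖ + 1
  refine IsBigO.of_bound (((m.factorial : ℝ))⁻¹ * C) ?_
  filter_upwards [Metric.ball_mem_nhds (0 : E) hε] with y hy
  rw [mem_ball_zero_iff] at hy
  have hmem : ∀ t ∈ Set.Icc (0 : ℝ) 1, x + t • y ∈ Metric.ball x ε := by
    intro t ht
    rw [Metric.mem_ball, dist_self_add_left, norm_smul, Real.norm_of_nonneg ht.1]
    nlinarith [ht.2, norm_nonneg y]
  rw [map_add_eq_sum_add_integral_iteratedFDeriv (f := f) (x := x) (y := y) (n := m)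
    (fun t ht => by exact_mod_cast (hb _ (hmem t ht)).1), add_sub_cancel_left, norm_smul,
    norm_inv, Real.norm_natCast, mul_assoc]
  gcongr
  rw [norm_pow, norm_norm]
  refine (intervalIntegral.norm_integral_le_of_norm_le_const (C := C * ‖y‖ ^ (m + 1)) ?_).trans
    (by simp)
  intro t ht
  rw [Set.uIoc_of_le zero_le_one] at ht
  have ht' : t ∈ Set.Icc (0 : ℝ) 1 := ⟨ht.1.le, ht.2⟩
  rw [norm_smul, norm_pow, Real.norm_of_nonneg (by linarith [ht.2])]
  have hp : (1 - t) ^ m ≤ 1 := pow_le_one₀ (by linarith [ht.2]) (by linarith [ht.1])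
  have h5 := (iteratedFDeriv ℝ (m + 1) f (x + t • y)).le_opNorm (fun _ => y)
  simp only [Finset.prod_const, Finset.card_univ, Fintype.card_fin] at h5
  have h6 := (hb _ (hmem t ht')).2.le
  calc (1 - t) ^ m * ‖iteratedFDeriv ℝ (m + 1) f (x + t • y) fun _ => y‖
      ≤ 1 * (‖iteratedFDeriv ℝ (m + 1) f (x + t • y)‖ * ‖y‖ ^ (m + 1)) := by gcongr
    _ ≤ C * ‖y‖ ^ (m + 1) := by rw [one_mul]; gcongr

lemma isBigO_of_iteratedFDeriv_eq_zero [CompleteSpace F] {f : E → F}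
    (hf : ContDiffAt ℝ (⊤ : ℕ∞) f 0) {m : ℕ} (h : ∀ j ≤ m, iteratedFDeriv ℝ j f 0 = 0) :
    f =O[𝓝 0] fun y => ‖y‖ ^ (m + 1) := by
  refine (taylor_isBigO hf m).congr_left fun y => ?_
  rw [Finset.sum_eq_zero, sub_zero, zero_add]
  intro k hk
  rw [h k (by simpa [Nat.lt_succ_iff] using hk)]
  simp

lemma iteratedFDeriv_eq_zero_of_isBigO [CompleteSpace F] {f : E → F}
    (hf : ContDiffAt ℝ (⊤ : ℕ∞) f 0) {m : ℕ} (h : f =O[𝓝 0] fun y => ‖y‖ ^ (m + 1)) :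
    ∀ j ≤ m, iteratedFDeriv ℝ j f 0 = 0 := by
  intro j
  induction j using Nat.strong_induction_on with
  | _ j ih =>
    intro hj
    refine (hf.of_le (by exact_mod_cast le_top)).iteratedFDeriv_eq_zero_of_diagonal fun v => ?_
    have h1 := taylor_isBigO hf j
    have h2 : f =O[𝓝 0] fun y => ‖y‖ ^ (j + 1) := by
      refine h.trans (IsBigO.of_bound 1 ?_)
      filter_upwards [Metric.ball_mem_nhds (0 : E) one_pos] with y hy
      rw [mem_ball_zero_iff] at hy
      rw [norm_pow, norm_pow, norm_norm, one_mul]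
      exact pow_le_pow_of_le_one (norm_nonneg _) hy.le (by omega)
    have h3 : (fun y => iteratedFDeriv ℝ j f 0 (fun _ => y)) =O[𝓝 0] fun y => ‖y‖ ^ (j + 1) := by
      have h4 := (h2.sub h1).const_smul_left (j.factorial : ℝ)
      refine h4.congr_left fun y => ?_
      simp only [zero_add, sub_sub_cancel, Pi.smul_apply]
      rw [Finset.sum_range_succ, Finset.sum_eq_zero]
      · rw [zero_add]
        rw [smul_inv_smul₀]
        exact_mod_cast j.factorial_ne_zero
      · intro k hk
        rw [Finset.mem_range] at hk
        rw [ih k hk (by omega)]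
        simp
    have ht : Tendsto (fun s : ℝ => s • v) (𝓝 0) (𝓝 0) := by
      have : Continuous (fun s : ℝ => s • v) := by fun_prop
      simpa using this.tendsto 0
    have h5 := h3.comp_tendsto ht
    have h6 : (fun s : ℝ => s ^ j • iteratedFDeriv ℝ j f 0 (fun _ => v)) =O[𝓝 0]
        fun s : ℝ => s ^ (j + 1) := by
      refine (h5.congr_left fun s => ?_).trans (IsBigO.of_bound (‖v‖ ^ (j + 1)) ?_)
      · have := (iteratedFDeriv ℝ j f 0).map_smul_univ (fun _ => s) (fun _ => v)
        simpa using this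
      · refine Eventually.of_forall fun s => ?_
        simp [norm_smul, mul_pow, mul_comm]
    by_contra hne
    obtain ⟨C, hC⟩ := h6.bound
    have h7 : ∀ᶠ s : ℝ in 𝓝[>] 0, ‖iteratedFDeriv ℝ j f 0 (fun _ => v)‖ ≤ C * s := by
      filter_upwards [hC.filter_mono nhdsWithin_le_nhds, self_mem_nhdsWithin] with s hs hs0
      have hs0 : 0 < s := hs0
      rw [norm_smul, norm_pow, norm_pow, Real.norm_of_nonneg hs0.le, pow_succ] at hs
      have : 0 < s ^ j := by positivity
      nlinarith
    have h8 : Tendsto (fun s : ℝ => C * s) (𝓝[>] 0) (𝓝 0) := by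
      have : Continuous (fun s : ℝ => C * s) := by fun_prop
      simpa using (this.tendsto 0).mono_left nhdsWithin_le_nhds
    exact hne (norm_le_zero_iff.1 (ge_of_tendsto h8 h7))

end Taylor

section Coefficients
open Filter Asymptotics ComplexConjugate

lemma Polynomial.X_pow_dvd_of_isBigO {P : Polynomial ℂ} {m : ℕ}
    (h : (fun ρ : ℝ => P.eval (ρ : ℂ)) =O[𝓝[>] 0] fun ρ => ρ ^ m) : X ^ m ∣ P := by
  suffices H : ∀ j ≤ m, X ^ j ∣ P from H m le_rfl
  intro j
  induction j with
  | zero => simp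
  | succ j ih =>
    intro hj
    obtain ⟨Q, rfl⟩ := ih (by omega)
    rw [pow_succ]
    refine mul_dvd_mul_left _ (X_dvd_iff.2 ?_)
    rw [coeff_zero_eq_eval_zero]
    obtain ⟨C, hC⟩ := h.bound
    have h1 : ∀ᶠ ρ : ℝ in 𝓝[>] 0, ‖Q.eval (ρ : ℂ)‖ ≤ C * ρ ^ (m - j) := by
      filter_upwards [hC, self_mem_nhdsWithin] with ρ hρ h0
      have h0 : 0 < ρ := h0
      rw [eval_mul, eval_pow, eval_X, norm_mul, norm_pow, norm_pow, Complex.norm_real,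
        Real.norm_of_nonneg h0.le, show m = j + (m - j) by omega, pow_add] at hρ
      have : 0 < ρ ^ j := by positivity
      refine le_of_mul_le_mul_left (hρ.trans_eq ?_) this
      ring
    have h2 : Tendsto (fun ρ : ℝ => C * ρ ^ (m - j)) (𝓝[>] 0) (𝓝 0) := by
      have hc : Continuous (fun ρ : ℝ => C * ρ ^ (m - j)) := by fun_prop
      have := (hc.tendsto 0).mono_left (nhdsWithin_le_nhds (s := Set.Ioi 0))
      rwa [zero_pow (by omega), mul_zero] at this
    have h3 : Tendsto (fun ρ : ℝ => ‖Q.eval (ρ : ℂ)‖) (𝓝[>] 0) (𝓝 ‖Q.eval 0‖) := by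
      have hc : Continuous (fun ρ : ℝ => ‖Q.eval (ρ : ℂ)‖) := by fun_prop
      simpa using (hc.tendsto 0).mono_left (nhdsWithin_le_nhds (s := Set.Ioi 0))
    exact norm_le_zero_iff.1 (le_of_tendsto_of_tendsto h3 h2 h1)

lemma coeff_eq_zero_of_isBigO (S : Finset (ℕ × ℕ)) (c : ℕ × ℕ → ℂ) {m : ℕ}
    (h : (fun t : ℂ => ∑ s ∈ S, c s * t ^ s.1 * conj t ^ s.2) =O[𝓝 0] fun t => ‖t‖ ^ (m + 1))
    {s₀ : ℕ × ℕ} (hs₀ : s₀ ∈ S) (hm : s₀.1 + s₀.2 ≤ m) : c s₀ = 0 := by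
  classical
  have key : ∀ u : Circle, ∑ s ∈ S with s.1 + s.2 = s₀.1 + s₀.2,
      c s * (u : ℂ) ^ s.1 * conj (u : ℂ) ^ s.2 = 0 := by
    intro u
    have ht : Tendsto (fun ρ : ℝ => (ρ : ℂ) * u) (𝓝[>] 0) (𝓝 0) := by
      have hc : Continuous (fun ρ : ℝ => (ρ : ℂ) * u) := by fun_prop
      simpa using (hc.tendsto 0).mono_left (nhdsWithin_le_nhds (s := Set.Ioi 0))
    have h1 : (fun ρ : ℝ => (∑ s ∈ S, Polynomial.C (c s * (u : ℂ) ^ s.1 * conj (u : ℂ) ^ s.2) *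
        Polynomial.X ^ (s.1 + s.2)).eval (ρ : ℂ)) =O[𝓝[>] 0] fun ρ => ρ ^ (m + 1) := by
      refine ((h.comp_tendsto ht).congr_left fun ρ => ?_).trans (IsBigO.of_bound 1 ?_)
      · simp only [Function.comp, Polynomial.eval_finsetSum]
        refine Finset.sum_congr rfl fun s _ => ?_
        simp
        ring
      · exact Eventually.of_forall fun ρ => by simp [Circle.norm_coe]
    have h2 := Polynomial.X_pow_dvd_iff.1 (Polynomial.X_pow_dvd_of_isBigO h1) (s₀.1 + s₀.2)
      (by omega)
    rw [Polynomial.finsetSum_coeff] at h2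
    simp only [Polynomial.coeff_C_mul_X_pow] at h2
    rw [Finset.sum_filter]
    simpa only [eq_comm] using h2
  have hQ : (∑ s ∈ S with s.1 + s.2 = s₀.1 + s₀.2,
      Polynomial.C (c s) * Polynomial.X ^ (2 * s.1)) = 0 := by
    refine Polynomial.eq_zero_of_infinite_isRoot _ ?_
    have : Infinite (Set.Ioc (-Real.pi) Real.pi) :=
      (Set.Ioc_infinite (by linarith [Real.pi_pos])).to_subtype
    have : Infinite Circle := Circle.argEquiv.infinite_iff.2 this
    have hinf : (Set.range fun u : Circle => (u : ℂ)).Infinite :=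
      Set.infinite_range_of_injective Circle.coe_injective
    refine hinf.mono ?_
    rintro _ ⟨u, rfl⟩
    have hu : (u : ℂ) * conj (u : ℂ) = 1 := by simp [Complex.mul_conj]
    have := congr((u : ℂ) ^ (s₀.1 + s₀.2) * $(key u))
    rw [mul_zero, Finset.mul_sum] at this
    rw [Set.mem_ofPred_eq, Polynomial.IsRoot, Polynomial.eval_finsetSum, ← this]
    refine Finset.sum_congr rfl fun s hs => ?_
    rw [← (Finset.mem_filter.1 hs).2]
    simp only [Polynomial.eval_mul, Polynomial.eval_C, Polynomial.eval_pow, Polynomial.eval_X]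
    calc c s * (u : ℂ) ^ (2 * s.1)
        = c s * (u : ℂ) ^ (2 * s.1) * (u * conj (u : ℂ)) ^ s.2 := by rw [hu, one_pow, mul_one]
      _ = _ := by ring
  have h3 := congr(Polynomial.coeff $hQ (2 * s₀.1))
  rw [Polynomial.finsetSum_coeff, Polynomial.coeff_zero, Finset.sum_eq_single s₀] at h3
  · simpa using h3
  · intro s hs hne
    rw [Polynomial.coeff_C_mul_X_pow, if_neg]
    intro h4
    have := (Finset.mem_filter.1 hs).2
    exact hne (Prod.ext (by omega) (by omega))
  · intro h4
    exact absurd (by simpa using hs₀) h4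

end Coefficients

section Box
open MvPolynomial

variable {n k : ℕ}

/-- Linear functionals on the polynomials of degree at most `k` in each of `n` variables, given
by their values on the monomials. -/
abbrev BoxSpace (n k : ℕ) : Type := EuclideanSpace ℂ (Fin n → Fin (k + 1))

/-- The exponent given by a point of the box. -/
noncomputable def boxExponent (α : Fin n → Fin (k + 1)) : Fin n →₀ ℕ :=
  Finsupp.equivFunOnFinite.symm fun i => (α i : ℕ)

@[simp] lemma boxExponent_apply (α : Fin n → Fin (k + 1)) (i : Fin n) :
    boxExponent α i = α i := rfl

/-- Extension by zero of a function on the box to all exponents. -/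
noncomputable def boxExt : BoxSpace n k →ₗ[ℂ] ((Fin n →₀ ℕ) → ℂ) where
  toFun e μ := if h : ∀ i, μ i < k + 1 then e fun i => ⟨μ i, h i⟩ else 0
  map_add' e e' := by
    ext μ
    by_cases h : ∀ i, μ i < k + 1
    · simp only [dif_pos h, Pi.add_apply, PiLp.add_apply]
    · simp only [dif_neg h, Pi.add_apply, add_zero]
  map_smul' c e := by
    ext μ
    by_cases h : ∀ i, μ i < k + 1
    · simp only [dif_pos h, Pi.smul_apply, PiLp.smul_apply,
        RingHom.id_apply]
    · simp only [dif_neg h, Pi.smul_apply, smul_zero]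

@[simp] lemma boxExt_boxExponent (e : BoxSpace n k) (α : Fin n → Fin (k + 1)) :
    boxExt e (boxExponent α) = e α :=
  dif_pos fun i => (α i).2

lemma boxExt_eq_zero (e : BoxSpace n k) {μ : Fin n →₀ ℕ} {i : Fin n} (h : k < μ i) :
    boxExt e μ = 0 :=
  dif_neg fun H => absurd (H i) (by omega)

lemma exists_boxExponent_eq {μ : Fin n →₀ ℕ} (h : ∀ i, μ i ≤ k) :
    ∃ α : Fin n → Fin (k + 1), boxExponent α = μ :=
  ⟨fun i => ⟨μ i, Nat.lt_succ_of_le (h i)⟩, by ext; rfl⟩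

/-- The transpose of multiplication by the `l`-th variable. -/
noncomputable def boxShift (l : Fin n) : BoxSpace n k →ₗ[ℂ] BoxSpace n k where
  toFun e := WithLp.toLp 2 fun α => boxExt e (boxExponent α + Finsupp.single l 1)
  map_add' e e' := by ext; simp
  map_smul' c e := by ext; simp

@[simp] lemma boxShift_apply (l : Fin n) (e : BoxSpace n k) (α : Fin n → Fin (k + 1)) :
    boxShift l e α = boxExt e (boxExponent α + Finsupp.single l 1) := rfl

lemma boxExt_boxShift (l : Fin n) (e : BoxSpace n k) (μ : Fin n →₀ ℕ) :
    boxExt (boxShift l e) μ = boxExt e (μ + Finsupp.single l 1) := by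
  by_cases h : ∀ i, μ i ≤ k
  · obtain ⟨α, rfl⟩ := exists_boxExponent_eq h
    simp
  · push Not at h
    obtain ⟨i, hi⟩ := h
    rw [boxExt_eq_zero _ hi, boxExt_eq_zero _ (i := i)]
    rw [Finsupp.add_apply]
    omega

/-- The functional on polynomials given by a point of the box space. -/
noncomputable def boxFunctional : BoxSpace n k →ₗ[ℂ] (MvPolynomial (Fin n) ℂ →ₗ[ℂ] ℂ) :=
  ((basisMonomials (Fin n) ℂ).constr ℂ).toLinearMap ∘ₗ boxExt

lemma boxFunctional_monomial (e : BoxSpace n k) (μ : Fin n →₀ ℕ) :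
    boxFunctional e (monomial μ 1) = boxExt e μ := by
  have := (basisMonomials (Fin n) ℂ).constr_basis ℂ (boxExt e) μ
  rwa [coe_basisMonomials] at this

lemma boxFunctional_X_mul (l : Fin n) (e : BoxSpace n k) (G : MvPolynomial (Fin n) ℂ) :
    boxFunctional e (X l * G) = boxFunctional (boxShift l e) G := by
  have : boxFunctional e ∘ₗ LinearMap.mulLeft ℂ (X l) = boxFunctional (boxShift l e) := by
    refine (basisMonomials (Fin n) ℂ).ext fun μ => ?_
    rw [coe_basisMonomials, LinearMap.comp_apply, LinearMap.mulLeft_apply, X, monomial_mul,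
      one_mul, boxFunctional_monomial, boxFunctional_monomial, boxExt_boxShift,
      add_comm μ]
  exact LinearMap.congr_fun this G

/-- Orthonormal families whose span is stable under all the shifts. -/
def IsShiftFrame {d : ℕ} (e : Fin d → BoxSpace n k) : Prop :=
  Orthonormal ℂ e ∧ ∀ l a, boxShift l (e a) = ∑ b, inner ℂ (e b) (boxShift l (e a)) • e b

lemma isCompact_isShiftFrame (n k d : ℕ) :
    IsCompact {e : Fin d → BoxSpace n k | IsShiftFrame e} := by
  refine Metric.isCompact_of_isClosed_isBounded ?_ ?_
  · have h : ∀ l : Fin n, Continuous (boxShift (k := k) l) := fun l =>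
      LinearMap.continuous_of_finiteDimensional _
    simp only [IsShiftFrame, orthonormal_iff_ite, Set.ofPred_and, Set.ofPred_forall]
    refine IsClosed.inter (isClosed_iInter fun i => isClosed_iInter fun j =>
      isClosed_eq (by fun_prop) continuous_const) (isClosed_iInter fun l =>
      isClosed_iInter fun a => ?_)
    have := h l
    exact isClosed_eq (by fun_prop) (by fun_prop)
  · refine (Metric.isBounded_closedBall (x := (0 : Fin d → BoxSpace n k)) (r := 1)).subset ?_
    intro e he
    rw [mem_closedBall_zero_iff, pi_norm_le_iff_of_nonneg zero_le_one]
    exact fun a => (he.1.1 a).le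

/-- The ideal of polynomials annihilated by a frame. -/
noncomputable def frameIdeal {d : ℕ} (e : Fin d → BoxSpace n k) (he : IsShiftFrame e) :
    Ideal (MvPolynomial (Fin n) ℂ) where
  carrier := {G | ∀ a, boxFunctional (e a) G = 0}
  add_mem' := fun {G H} hG hH a => by rw [map_add, hG a, hH a, add_zero]
  zero_mem' := fun a => map_zero _
  smul_mem' := by
    intro F
    induction F using MvPolynomial.induction_on with
    | C c =>
      intro G hG a
      rw [smul_eq_mul, ← smul_eq_C_mul, map_smul, hG a, smul_zero]
    | add F F' hF hF' =>
      intro G hG a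
      rw [smul_eq_mul, add_mul, map_add, ← smul_eq_mul, ← smul_eq_mul, hF hG a, hF' hG a, add_zero]
    | mul_X F l hF =>
      intro G hG
      rw [smul_eq_mul, mul_assoc]
      refine hF (x := X l * G) fun a => ?_
      rw [boxFunctional_X_mul, he.2 l a, map_sum, LinearMap.sum_apply]
      refine Finset.sum_eq_zero fun b _ => ?_
      rw [map_smul, LinearMap.smul_apply, hG b, smul_zero]

lemma mem_frameIdeal {d : ℕ} {e : Fin d → BoxSpace n k} {he : IsShiftFrame e}
    {G : MvPolynomial (Fin n) ℂ} : G ∈ frameIdeal e he ↔ ∀ a, boxFunctional (e a) G = 0 := Iff.rfl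

lemma X_pow_mem_frameIdeal {d : ℕ} {e : Fin d → BoxSpace n k} (he : IsShiftFrame e) (i : Fin n) :
    X i ^ (k + 1) ∈ frameIdeal e he := fun a => by
  rw [X_pow_eq_monomial, boxFunctional_monomial]
  exact boxExt_eq_zero _ (i := i) (by simp)

/-- The polynomial dual to a point of the box space. -/
noncomputable def boxDual (e : BoxSpace n k) : MvPolynomial (Fin n) ℂ :=
  ∑ α, (starRingEnd ℂ) (e α) • monomial (boxExponent α) 1

lemma boxFunctional_boxDual (e e' : BoxSpace n k) :
    boxFunctional e (boxDual e') = inner ℂ e' e := by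
  rw [boxDual, map_sum, PiLp.inner_apply]
  refine Finset.sum_congr rfl fun α _ => ?_
  rw [map_smul, boxFunctional_monomial, boxExt_boxExponent, RCLike.inner_apply, smul_eq_mul,
    mul_comm]

lemma monomial_sub_mem_frameIdeal {d : ℕ} {e : Fin d → BoxSpace n k} (he : IsShiftFrame e)
    (α : Fin n → Fin (k + 1)) :
    monomial (boxExponent α) 1 - ∑ a, e a α • boxDual (e a) ∈ frameIdeal e he := fun b => by
  rw [map_sub, boxFunctional_monomial, boxExt_boxExponent, map_sum, Finset.sum_eq_single b]
  · rw [map_smul, boxFunctional_boxDual, orthonormal_iff_ite.1 he.1, if_pos rfl, smul_eq_mul,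
      mul_one, sub_self]
  · intro a _ hab
    rw [map_smul, boxFunctional_boxDual, orthonormal_iff_ite.1 he.1, if_neg hab, smul_zero]
  · simp

lemma finrank_quotient_frameIdeal {d : ℕ} {e : Fin d → BoxSpace n k} (he : IsShiftFrame e) :
    Module.finrank ℂ (MvPolynomial (Fin n) ℂ ⧸ frameIdeal e he) = d := by
  have hker : LinearMap.ker (LinearMap.pi fun a => boxFunctional (e a)) =
      (frameIdeal e he).restrictScalars ℂ := by
    ext G
    simp [mem_frameIdeal, funext_iff]
  have hsurj : Function.Surjective (LinearMap.pi fun a => boxFunctional (e a)) := by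
    intro v
    refine ⟨∑ b, v b • boxDual (e b), funext fun a => ?_⟩
    rw [LinearMap.pi_apply, map_sum, Finset.sum_eq_single a]
    · rw [map_smul, boxFunctional_boxDual, orthonormal_iff_ite.1 he.1, if_pos rfl, smul_eq_mul,
        mul_one]
    · intro b _ hab
      rw [map_smul, boxFunctional_boxDual, orthonormal_iff_ite.1 he.1, if_neg hab, smul_zero]
    · simp
  have e1 := (LinearMap.pi fun a => boxFunctional (e a)).quotKerEquivOfSurjective hsurj
  rw [hker] at e1
  have h2 : Module.finrank ℂ (MvPolynomial (Fin n) ℂ ⧸ frameIdeal e he) =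
    Module.finrank ℂ (Fin d → ℂ) := LinearEquiv.finrank_eq e1
  rw [h2, Module.finrank_fin_fun]

end Box

section Expansion
open Filter Asymptotics ComplexConjugate

variable {n k : ℕ}

/-- The monomial with exponent `α`. -/
def boxMonomial (ζ : Fin n → ℂ) (α : Fin n → Fin (k + 1)) : ℂ := ∏ i, ζ i ^ (α i : ℕ)

/-- The sesquilinear form with coefficients `c`. -/
noncomputable def sesq {ι : Type*} [Fintype ι] (c : ι → ι → ℂ) (u v : ι → ℂ) : ℂ :=
  ∑ α, ∑ β, c α β * (u α * conj (v β))

lemma sesq_sum {ι κ : Type*} [Fintype ι] (c : ι → ι → ℂ) (s s' : Finset κ) (q q' : κ → ℂ)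
    (e e' : κ → ι → ℂ) :
    sesq c (fun α => ∑ a ∈ s, q a * e a α) (fun α => ∑ a ∈ s', q' a * e' a α) =
      ∑ a ∈ s, ∑ b ∈ s', sesq c (e a) (e' b) * (q a * conj (q' b)) := by
  have h1 : ∀ α β, c α β * ((∑ a ∈ s, q a * e a α) * conj (∑ a ∈ s', q' a * e' a β)) =
      ∑ a ∈ s, ∑ b ∈ s', c α β * (e a α * conj (e' b β)) * (q a * conj (q' b)) := by
    intro α β
    rw [map_sum, Finset.sum_mul_sum, Finset.mul_sum]
    refine Finset.sum_congr rfl fun a _ => ?_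
    rw [Finset.mul_sum]
    refine Finset.sum_congr rfl fun b _ => ?_
    rw [map_mul]
    ring
  have h2 : sesq c (fun α => ∑ a ∈ s, q a * e a α) (fun α => ∑ a ∈ s', q' a * e' a α) =
      ∑ α, ∑ β, ∑ a ∈ s, ∑ b ∈ s', c α β * (e a α * conj (e' b β)) * (q a * conj (q' b)) :=
    Finset.sum_congr rfl fun α _ => Finset.sum_congr rfl fun β _ => h1 α β
  rw [h2]
  simp only [sesq, Finset.sum_mul]
  simp only [Finset.sum_comm (s := Finset.univ) (t := s),
    Finset.sum_comm (s := Finset.univ) (t := s')]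

lemma sesq_eq_zero_of_mem_span {ι κ : Type*} [Fintype ι] {c : ι → ι → ℂ} {e : κ → ι → ℂ}
    (h : ∀ a b, sesq c (e a) (e b) = 0) {u v : ι → ℂ} (hu : u ∈ Submodule.span ℂ (Set.range e))
    (hv : v ∈ Submodule.span ℂ (Set.range e)) : sesq c u v = 0 := by
  obtain ⟨q, rfl⟩ := (Finsupp.mem_span_range_iff_exists_finsupp).1 hu
  obtain ⟨q', rfl⟩ := (Finsupp.mem_span_range_iff_exists_finsupp).1 hv
  have := sesq_sum c q.support q'.support q q' e e
  simp only [h, zero_mul, Finset.sum_const_zero] at this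
  rw [← this]
  congr 1 <;> ext α <;> simp [Finsupp.sum, Finset.sum_apply]

/-- Pairs of functions bounded near `0` that differ by `O(h)`. -/
def congrSubalgebra (h : ℂ → ℝ) : Subalgebra ℂ ((ℂ → ℂ) × (ℂ → ℂ)) where
  carrier := {f | f.1 =O[𝓝 0] (fun _ => (1 : ℝ)) ∧ f.2 =O[𝓝 0] (fun _ => (1 : ℝ)) ∧
    (f.1 - f.2) =O[𝓝 0] h}
  add_mem' := fun {f g} hf hg => ⟨hf.1.add hg.1, hf.2.1.add hg.2.1,
    (hf.2.2.add hg.2.2).congr_left fun _ => (add_sub_add_comm _ _ _ _).symm⟩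
  mul_mem' := fun {f g} hf hg => by
    refine ⟨(hf.1.mul hg.1).congr_right (by simp), (hf.2.1.mul hg.2.1).congr_right (by simp), ?_⟩
    have h1 := (hf.1.mul hg.2.2).congr_right (g₂ := h) (by simp)
    have h2 := (hf.2.2.mul hg.2.1).congr_right (g₂ := h) (by simp)
    refine (h1.add h2).congr_left fun t => ?_
    simp only [Prod.fst_mul, Prod.snd_mul, Pi.sub_apply, Pi.mul_apply]
    ring
  algebraMap_mem' := fun c => by
    refine ⟨isBigO_const_const c one_ne_zero _, isBigO_const_const c one_ne_zero _, ?_⟩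
    refine (isBigO_zero h (𝓝 0)).congr_left fun t => ?_
    simp [Prod.algebraMap_apply]

lemma mem_congrSubalgebra {h : ℂ → ℝ} {f g : ℂ → ℂ} : (f, g) ∈ congrSubalgebra h ↔
    f =O[𝓝 0] (fun _ => (1 : ℝ)) ∧ g =O[𝓝 0] (fun _ => (1 : ℝ)) ∧ (f - g) =O[𝓝 0] h := Iff.rfl

lemma conj_mem_congrSubalgebra {h : ℂ → ℝ} {f g : ℂ → ℂ} (H : (f, g) ∈ congrSubalgebra h) :
    ((fun t => conj (f t)), (fun t => conj (g t))) ∈ congrSubalgebra h := by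
  rw [mem_congrSubalgebra] at *
  refine ⟨?_, ?_, ?_⟩
  · exact isBigO_norm_left.1 (by simpa only [RCLike.norm_conj] using H.1.norm_left)
  · exact isBigO_norm_left.1 (by simpa only [RCLike.norm_conj] using H.2.1.norm_left)
  · refine isBigO_norm_left.1 (H.2.2.norm_left.congr_left fun t => ?_)
    simp only [Pi.sub_apply, ← map_sub, RCLike.norm_conj]

lemma sesq_sub_isBigO {ι : Type*} [Fintype ι] {h : ℂ → ℝ} {u v : ι → ℂ → ℂ}
    (H : ∀ α, (u α, v α) ∈ congrSubalgebra h) (c : ι → ι → ℂ) :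
    (fun t => sesq c (fun α => u α t) (fun α => u α t) -
      sesq c (fun α => v α t) (fun α => v α t)) =O[𝓝 0] h := by
  have h1 : ∑ α, ∑ β, c α β • ((u α, v α) * ((fun t => conj (u β t)), (fun t => conj (v β t)))) ∈
      congrSubalgebra h :=
    sum_mem fun α _ => sum_mem fun β _ => (congrSubalgebra h).smul_mem
      (mul_mem (H α) (conj_mem_congrSubalgebra (H β))) _
  refine h1.2.2.congr_left fun t => ?_
  simp only [Prod.fst_sum, Prod.snd_sum, Pi.sub_apply, Finset.sum_apply, sesq, Prod.smul_fst,
    Prod.smul_snd, Prod.fst_mul, Prod.snd_mul, Pi.smul_apply, Pi.mul_apply, smul_eq_mul]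

lemma boxMonomial_mem_congrSubalgebra {h : ℂ → ℝ} {u v : ℂ → Fin n → ℂ}
    (H : ∀ i, ((fun t => u t i), (fun t => v t i)) ∈ congrSubalgebra h)
    (α : Fin n → Fin (k + 1)) :
    ((fun t => boxMonomial (u t) α), (fun t => boxMonomial (v t) α)) ∈ congrSubalgebra h := by
  have h1 : ∏ i, ((fun t => u t i), (fun t => v t i)) ^ (α i : ℕ) ∈ congrSubalgebra h :=
    prod_mem fun i _ => pow_mem (H i) _
  convert h1
  · simp [boxMonomial, Prod.fst_prod]
  · simp [boxMonomial, Prod.snd_prod]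

end Expansion

section TaylorCoefficients
open Filter Asymptotics ComplexConjugate MvPolynomial

variable {n k : ℕ}

lemma sum_coeff_mul_boxMonomial (T : MvPolynomial (Fin n ⊕ Fin n) ℂ) (hT : T.totalDegree ≤ k)
    (ζ : Fin n → ℂ) : sesq (fun α β : Fin n → Fin (k + 1) =>
      T.coeff (Finsupp.equivFunOnFinite.symm (Sum.elim (fun i => (α i : ℕ)) fun i => (β i : ℕ))))
      (boxMonomial ζ) (boxMonomial ζ) = eval (Sum.elim ζ fun i => conj (ζ i)) T := by
  classical
  let φ : (Fin n → Fin (k + 1)) × (Fin n → Fin (k + 1)) → (Fin n ⊕ Fin n →₀ ℕ) := fun s =>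
    Finsupp.equivFunOnFinite.symm (Sum.elim (fun i => (s.1 i : ℕ)) fun i => (s.2 i : ℕ))
  have hφ : Function.Injective φ := by
    intro s s' h
    refine Prod.ext (funext fun i => Fin.ext ?_) (funext fun i => Fin.ext ?_)
    · exact DFunLike.congr_fun h (Sum.inl i)
    · exact DFunLike.congr_fun h (Sum.inr i)
  have hsub : T.support ⊆ Finset.univ.image φ := by
    intro μ hμ
    have hle : ∀ x, μ x < k + 1 := fun x => Nat.lt_succ_of_le
      (((Finsupp.le_degree x μ).trans (le_totalDegree hμ)).trans hT)
    refine Finset.mem_image.2 ⟨(fun i => ⟨_, hle (Sum.inl i)⟩, fun i => ⟨_, hle (Sum.inr i)⟩),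
      Finset.mem_univ _, ?_⟩
    ext x
    cases x <;> rfl
  rw [eval_eq', Finset.sum_subset hsub fun μ _ hμ => by rw [notMem_support_iff.1 hμ, zero_mul],
    Finset.sum_image hφ.injOn, ← Finset.univ_product_univ, Finset.sum_product]
  refine Finset.sum_congr rfl fun α _ => Finset.sum_congr rfl fun β _ => ?_
  simp [φ, boxMonomial, Fintype.prod_sum_type]

lemma exists_taylor_coeff {U : Set (Fin n → ℂ)} (hU : IsOpen U) {r : (Fin n → ℂ) → ℝ}
    (hr : ContDiffOn ℝ (⊤ : ℕ∞) r U) (k : ℕ) :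
    ∃ c : (Fin n → ℂ) → (Fin n → Fin (k + 1)) → (Fin n → Fin (k + 1)) → ℂ,
      (∀ α β, ContinuousOn (fun p => c p α β) U) ∧
      ∀ p ∈ U, (fun ζ => (r (p + ζ) : ℂ) - sesq (c p) (boxMonomial ζ) (boxMonomial ζ)) =O[𝓝 0]
        fun ζ => ‖ζ‖ ^ (k + 1) := by
  let b : Fin n × Bool → Fin n → ℂ := fun q => Pi.single q.1 (if q.2 then 1 else Complex.I)
  let x : (Fin n → ℂ) → Fin n × Bool → ℝ := fun ζ q => if q.2 then (ζ q.1).re else (ζ q.1).im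
  let Y : Fin n × Bool → MvPolynomial (Fin n ⊕ Fin n) ℂ := fun q =>
    if q.2 then C (1 / 2) * (X (Sum.inl q.1) + X (Sum.inr q.1))
    else C (1 / (2 * Complex.I)) * (X (Sum.inl q.1) - X (Sum.inr q.1))
  have hY : ∀ ζ q, eval (Sum.elim ζ fun i => conj (ζ i)) (Y q) = x ζ q := by
    rintro ζ ⟨i, _ | _⟩
    · simp only [Y, x, Bool.false_eq_true, if_false, map_mul, eval_C, map_sub, eval_X,
        Sum.elim_inl, Sum.elim_inr, Complex.sub_conj]
      field_simp
      push_cast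
      ring
    · simp only [Y, x, if_true, map_mul, eval_C, map_add, eval_X,
        Sum.elim_inl, Sum.elim_inr, Complex.add_conj]
      push_cast
      ring
  have hYdeg : ∀ q, (Y q).totalDegree ≤ 1 := by
    rintro ⟨i, _ | _⟩
    · simp only [Y, Bool.false_eq_true, if_false]
      refine (totalDegree_mul _ _).trans ?_
      rw [totalDegree_C, zero_add]
      exact (totalDegree_sub _ _).trans (by simp)
    · simp only [Y, if_true]
      refine (totalDegree_mul _ _).trans ?_
      rw [totalDegree_C, zero_add]
      exact (totalDegree_add _ _).trans (by simp)
  have hζ : ∀ ζ, ζ = ∑ q, x ζ q • b q := by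
    intro ζ
    ext i
    rw [Finset.sum_apply, Fintype.sum_prod_type, Finset.sum_eq_single i]
    · simp [x, b, Complex.re_add_im]
    · intro j _ hj
      simp [b, Pi.single_eq_of_ne' hj]
    · simp
  let T : (Fin n → ℂ) → MvPolynomial (Fin n ⊕ Fin n) ℂ := fun p =>
    ∑ j ∈ Finset.range (k + 1), ∑ s : Fin j → Fin n × Bool,
      C (((j.factorial : ℝ)⁻¹ * iteratedFDeriv ℝ j r p (fun l => b (s l)) : ℝ) : ℂ) * ∏ l, Y (s l)
  refine ⟨fun p α β => (T p).coeff (Finsupp.equivFunOnFinite.symm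
    (Sum.elim (fun i => (α i : ℕ)) fun i => (β i : ℕ))), fun α β => ?_, fun p hp => ?_⟩
  · simp only [T, coeff_sum, coeff_C_mul]
    refine continuousOn_finsetSum _ fun j _ => continuousOn_finsetSum _ fun s _ =>
      ContinuousOn.mul ?_ continuousOn_const
    have h1 : ContinuousOn (iteratedFDeriv ℝ j r) U := fun p hp =>
      ((hr.contDiffAt (hU.mem_nhds hp)).differentiableAt_iteratedFDeriv
        (by exact_mod_cast ENat.natCast_lt_top _)).continuousAt.continuousWithinAt
    refine Complex.continuous_ofReal.comp_continuousOn (continuousOn_const.mul ?_)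
    exact (ContinuousMultilinearMap.apply ℝ (fun _ : Fin j => Fin n → ℂ) ℝ
      (fun l => b (s l))).continuous.comp_continuousOn h1
  · have hdeg : (T p).totalDegree ≤ k := by
      refine totalDegree_finsetSum_le fun j hj => totalDegree_finsetSum_le fun s _ => ?_
      refine (totalDegree_mul _ _).trans ?_
      rw [totalDegree_C, zero_add]
      refine (totalDegree_finsetProd _ _).trans ((Finset.sum_le_card_nsmul _ _ 1 fun l _ =>
        hYdeg _).trans ?_)
      simpa using Nat.lt_succ_iff.1 (Finset.mem_range.1 hj)
    have h1 := taylor_isBigO (hr.contDiffAt (hU.mem_nhds hp)) k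
    refine IsBigO.trans (IsBigO.of_bound 1 (Eventually.of_forall fun ζ => ?_)) h1
    rw [sum_coeff_mul_boxMonomial _ hdeg]
    have h2 : eval (Sum.elim ζ fun i => conj (ζ i)) (T p) =
        ((∑ j ∈ Finset.range (k + 1), ((j.factorial : ℝ))⁻¹ •
          iteratedFDeriv ℝ j r p (fun _ => ζ) : ℝ) : ℂ) := by
      simp only [T, map_sum, map_mul, eval_C, map_prod, hY, Complex.ofReal_sum]
      refine Finset.sum_congr rfl fun j _ => ?_
      have h3 : iteratedFDeriv ℝ j r p (fun _ => ζ) = ∑ s : Fin j → Fin n × Bool,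
          (∏ l, x ζ (s l)) * iteratedFDeriv ℝ j r p (fun l => b (s l)) := by
        conv_lhs => rw [hζ ζ]
        rw [ContinuousMultilinearMap.map_sum]
        refine Finset.sum_congr rfl fun s _ => ?_
        rw [ContinuousMultilinearMap.map_smul_univ, smul_eq_mul]
      rw [h3, smul_eq_mul, Finset.mul_sum, Complex.ofReal_sum]
      refine Finset.sum_congr rfl fun s _ => ?_
      push_cast
      ring
    rw [h2, ← Complex.ofReal_sub, Complex.norm_real, one_mul]

end TaylorCoefficients

section Order
open Filter Asymptotics

lemma natCast_lt_vOrder_iff {E F : Type*} [NormedAddCommGroup E] [NormedSpace ℝ E]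
    [NormedAddCommGroup F] [NormedSpace ℝ F] [CompleteSpace F] {f : E → F}
    (hf : ContDiffAt ℝ (⊤ : ℕ∞) f 0) {m : ℕ} :
    (m : ℝ≥0∞) < vOrder f ↔ f =O[𝓝 0] fun y => ‖y‖ ^ (m + 1) := by
  refine ⟨fun h => isBigO_of_iteratedFDeriv_eq_zero hf fun j hj => ?_, fun h => ?_⟩
  · by_contra h0
    exact absurd (h.trans_le (iInf₂_le j h0)) (by simpa using hj)
  · refine lt_of_lt_of_le (b := ((m + 1 : ℕ) : ℝ≥0∞)) (by exact_mod_cast m.lt_succ_self)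
      (le_iInf₂ fun j hj => ?_)
    by_contra! h1
    exact hj (iteratedFDeriv_eq_zero_of_isBigO hf h j (Nat.lt_succ_iff.1 (by exact_mod_cast h1)))

lemma isBigO_norm_pow {E F : Type*} [NormedAddCommGroup E] {f : E → F} [NormedAddCommGroup F]
    {m m' : ℕ} (h : m ≤ m') (hf : f =O[𝓝 0] fun y : E => ‖y‖ ^ m') :
    f =O[𝓝 0] fun y => ‖y‖ ^ m :=
  hf.trans (IsBigO.of_norm_left (by
    simpa using (isBigO_refl (fun y : E => ‖y‖ ^ m) _).mul
      (((continuous_norm (E := E)).pow (m' - m)).continuousAt.isBigO_one ℝ)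
      |>.congr_left fun y => by
        simp only [Pi.pow_apply]
        rw [← pow_add, Nat.add_sub_cancel' h]))

end Order

section Curve
open Filter Asymptotics

lemma Polynomial.X_pow_dvd_iff_isBigO {P : Polynomial ℂ} {m : ℕ} :
    X ^ m ∣ P ↔ (fun t => P.eval t) =O[𝓝 0] fun t : ℂ => ‖t‖ ^ m := by
  constructor
  · rintro ⟨Q, rfl⟩
    have hQ : (fun t => Q.eval t) =O[𝓝 0] fun _ : ℂ => (1 : ℝ) :=
      Q.continuous.continuousAt.isBigO_one ℝ
    refine ((isBigO_refl (fun t : ℂ => t ^ m) _).norm_right.mul hQ).congr ?_ ?_ <;> intro t <;> simp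
  · intro h
    have ht : Tendsto (fun ρ : ℝ => (ρ : ℂ)) (𝓝[>] 0) (𝓝 0) := by
      simpa using (Complex.continuous_ofReal.tendsto 0).mono_left
        (nhdsWithin_le_nhds (s := Set.Ioi 0))
    exact X_pow_dvd_of_isBigO ((h.comp_tendsto ht).trans
      (IsBigO.of_bound 1 (Eventually.of_forall fun ρ => by simp)))

lemma eval_mem_congrSubalgebra {P Q : Polynomial ℂ} {m : ℕ} (h : Polynomial.X ^ m ∣ P - Q) :
    ((fun t => P.eval t), (fun t => Q.eval t)) ∈ congrSubalgebra fun t => ‖t‖ ^ m := by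
  refine mem_congrSubalgebra.2 ⟨P.continuous.continuousAt.isBigO_one ℝ,
    Q.continuous.continuousAt.isBigO_one ℝ, ?_⟩
  exact (Polynomial.X_pow_dvd_iff_isBigO.1 h).congr_left fun t => Polynomial.eval_sub _ _ _

lemma AnalyticAt.exists_polynomial_isBigO {f : ℂ → ℂ} (hf : AnalyticAt ℂ f 0) (L : ℕ) :
    ∃ P : Polynomial ℂ, (fun t => f t - P.eval t) =O[𝓝 0] fun t => ‖t‖ ^ L := by
  obtain ⟨q, hq⟩ := hf
  refine ⟨∑ i ∈ Finset.range L, Polynomial.C (q.coeff i) * Polynomial.X ^ i,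
    (hq.isBigO_sub_partialSum_pow L).congr_left fun t => ?_⟩
  rw [zero_add, FormalMultilinearSeries.partialSum, Polynomial.eval_finsetSum]
  refine congrArg (f t - ·) (Finset.sum_congr rfl fun i _ => ?_)
  rw [FormalMultilinearSeries.apply_eq_pow_smul_coeff, Polynomial.eval_mul, Polynomial.eval_C,
    Polynomial.eval_pow, Polynomial.eval_X, smul_eq_mul, mul_comm]

lemma AnalyticAt.exists_not_isBigO {f : ℂ → ℂ} (hf : AnalyticAt ℂ f 0)
    (h : ¬ ∀ᶠ t in 𝓝 0, f t = 0) : ∃ b : ℕ, ¬ f =O[𝓝 0] fun t => ‖t‖ ^ b := by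
  obtain ⟨b, hb⟩ := ENat.ne_top_iff_exists.1 (mt analyticOrderAt_eq_top.1 h)
  obtain ⟨g, hg, hg0, hfg⟩ := (hf.analyticOrderAt_eq_natCast).1 hb.symm
  refine ⟨b + 1, fun H => hg0 ?_⟩
  obtain ⟨C, hC⟩ := H.bound
  have h1 : ∀ᶠ t in 𝓝[≠] (0 : ℂ), ‖g t‖ ≤ C * ‖t‖ := by
    filter_upwards [nhdsWithin_le_nhds hC, nhdsWithin_le_nhds hfg, self_mem_nhdsWithin]
      with t h1 h2 h3
    have h3 : 0 < ‖t‖ := norm_pos_iff.2 h3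
    rw [h2, sub_zero, smul_eq_mul, norm_mul, norm_pow, norm_pow, norm_norm, pow_succ] at h1
    refine le_of_mul_le_mul_left (h1.trans_eq ?_) (pow_pos h3 b)
    ring
  have h2 : Tendsto (fun t : ℂ => C * ‖t‖) (𝓝[≠] 0) (𝓝 0) := by
    have hc : Continuous (fun t : ℂ => C * ‖t‖) := by fun_prop
    simpa using (hc.tendsto 0).mono_left (nhdsWithin_le_nhds (s := {0}ᶜ))
  have h3 := (hg.continuousAt.tendsto.mono_left (nhdsWithin_le_nhds (s := {0}ᶜ))).norm
  exact norm_le_zero_iff.1 (le_of_tendsto_of_tendsto h3 h2 h1)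

end Curve

section ShiftStable
open Polynomial

variable {n k : ℕ}

/-- The coefficient of degree `i` of the monomials of the box along a polynomial curve. -/
noncomputable def boxCoeff (k : ℕ) (Γ : Fin n → Polynomial ℂ) (i : ℕ) : BoxSpace n k :=
  WithLp.toLp 2 fun α => (∏ l, Γ l ^ (α l : ℕ)).coeff i

@[simp] lemma boxCoeff_apply (Γ : Fin n → Polynomial ℂ) (i : ℕ) (α : Fin n → Fin (k + 1)) :
    boxCoeff k Γ i α = (∏ l, Γ l ^ (α l : ℕ)).coeff i := rfl

lemma boxExt_boxCoeff {Γ : Fin n → Polynomial ℂ} {a : ℕ} (hΓ : ∀ l, X ^ a ∣ Γ l) {i : ℕ}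
    (hi : i < a * (k + 1)) (μ : Fin n →₀ ℕ) :
    boxExt (boxCoeff k Γ i) μ = (∏ l, Γ l ^ μ l).coeff i := by
  by_cases h : ∀ l, μ l ≤ k
  · obtain ⟨α, rfl⟩ := exists_boxExponent_eq h
    simp
  · push Not at h
    obtain ⟨l, hl⟩ := h
    rw [boxExt_eq_zero _ hl]
    have h1 : X ^ (a * (k + 1)) ∣ ∏ l, Γ l ^ μ l :=
      ((pow_mul (X : Polynomial ℂ) a (k + 1) ▸ pow_dvd_pow_of_dvd (hΓ l) (k + 1)).trans
        (pow_dvd_pow _ hl)).trans (Finset.dvd_prod_of_mem _ (Finset.mem_univ l))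
    exact (X_pow_dvd_iff.1 h1 i hi).symm

lemma boxShift_boxCoeff {Γ : Fin n → Polynomial ℂ} {a : ℕ} (hΓ : ∀ l, X ^ a ∣ Γ l) {i : ℕ}
    (hi : i < a * (k + 1)) (l : Fin n) :
    boxShift l (boxCoeff k Γ i) =
      ∑ s ∈ Finset.HasAntidiagonal.antidiagonal i, (Γ l).coeff s.2 • boxCoeff k Γ s.1 := by
  ext α
  rw [boxShift_apply, boxExt_boxCoeff hΓ hi]
  have : ∏ j, Γ j ^ (boxExponent α + Finsupp.single l 1 : Fin n →₀ ℕ) j =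
      (∏ j, Γ j ^ (α j : ℕ)) * Γ l := by
    simp only [Finsupp.add_apply, boxExponent_apply, pow_add, Finset.prod_mul_distrib]
    congr 1
    rw [Finset.prod_eq_single l]
    · simp
    · intro j _ hj
      simp [Finsupp.single_eq_of_ne hj]
    · simp
  rw [this, coeff_mul]
  simp [mul_comm]

lemma linearIndependent_boxCoeff {Γ : Fin n → Polynomial ℂ} {a D : ℕ} (ha : 0 < a) (hD : D ≤ k)
    {l : Fin n}
    (hΓ : X ^ a ∣ Γ l) (h0 : (Γ l).coeff a ≠ 0) :
    LinearIndependent ℂ fun j : Fin (D + 1) => boxCoeff k Γ (a * j) := by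
  classical
  let β : Fin (D + 1) → Fin n → Fin (k + 1) := fun i => Pi.single l ⟨i, by omega⟩
  let φ : BoxSpace n k →ₗ[ℂ] (Fin (D + 1) → ℂ) :=
    { toFun := fun e i => e (β i), map_add' := fun _ _ => rfl, map_smul' := fun _ _ => rfl }
  obtain ⟨Q, hQ⟩ := hΓ
  have hM : ∀ j i : Fin (D + 1), φ (boxCoeff k Γ (a * j)) i =
      (X ^ (a * i) * Q ^ (i : ℕ)).coeff (a * j) := by
    intro j i
    change (∏ m, Γ m ^ (β i m : ℕ)).coeff _ = _
    rw [Finset.prod_eq_single l]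
    · simp only [β, Pi.single_eq_same]
      rw [hQ, mul_pow, ← pow_mul]
    · intro m _ hm
      simp [β, Pi.single_eq_of_ne hm]
    · simp
  refine LinearIndependent.of_comp φ ?_
  let A : Matrix (Fin (D + 1)) (Fin (D + 1)) ℂ := fun j => φ (boxCoeff k Γ (a * j))
  refine Matrix.linearIndependent_rows_of_det_ne_zero (A := A) ?_
  have hQ0 : Q.coeff 0 ≠ 0 := by
    rwa [hQ, coeff_X_pow_mul', if_pos le_rfl, Nat.sub_self] at h0
  rw [Matrix.det_of_isLowerTriangular]
  · refine Finset.prod_ne_zero_iff.2 fun i _ => ?_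
    simp only [A, hM]
    rw [coeff_X_pow_mul', if_pos le_rfl, Nat.sub_self, coeff_zero_eq_eval_zero, eval_pow,
      ← coeff_zero_eq_eval_zero]
    exact pow_ne_zero _ hQ0
  · intro j i hji
    have hji : j < i := by simpa using hji
    simp only [A, hM]
    rw [coeff_X_pow_mul', if_neg]
    exact not_le.2 (Nat.mul_lt_mul_of_pos_left hji ha)

lemma exists_isShiftFrame_of_boxShift_mem (W : Submodule ℂ (BoxSpace n k))
    (hW : ∀ l, ∀ e ∈ W, boxShift l e ∈ W) :
    ∃ e : Fin (Module.finrank ℂ W) → BoxSpace n k, IsShiftFrame e ∧ ∀ a, e a ∈ W := by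
  let b := stdOrthonormalBasis ℂ W
  refine ⟨fun a => b a, ⟨?_, fun l a => ?_⟩, fun a => (b a).2⟩
  · exact b.orthonormal.comp_linearIsometry W.subtypeₗᵢ
  · have := congr((($(b.sum_repr' ⟨boxShift l (b a), hW l _ (b a).2⟩) : W) : BoxSpace n k))
    simpa using this.symm

lemma exists_isShiftFrame_of_curve {Γ : Fin n → Polynomial ℂ} {a D : ℕ} (ha : 0 < a) (hD : D ≤ k)
    (hΓ : ∀ l, X ^ a ∣ Γ l) {l : Fin n} (h0 : (Γ l).coeff a ≠ 0) :
    ∃ d ∈ Finset.Icc (D + 1) (Fintype.card (Fin n → Fin (k + 1))), ∃ e : Fin d → BoxSpace n k,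
      IsShiftFrame e ∧
        ∀ b, e b ∈ Submodule.span ℂ (Set.range fun i : Fin (a * D + 1) => boxCoeff k Γ i) := by
  have hmem : ∀ i ≤ a * D, boxCoeff k Γ i ∈
      Submodule.span ℂ (Set.range fun i : Fin (a * D + 1) => boxCoeff k Γ i) := fun i hi =>
    Submodule.subset_span ⟨⟨i, by omega⟩, rfl⟩
  set W := Submodule.span ℂ (Set.range fun i : Fin (a * D + 1) => boxCoeff k Γ i) with hWdef
  obtain ⟨e, he, heW⟩ := exists_isShiftFrame_of_boxShift_mem W fun m => by
    suffices W ≤ W.comap (boxShift m) from this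
    rw [hWdef, Submodule.span_le]
    rintro _ ⟨i, rfl⟩
    have hi : (i : ℕ) ≤ a * D := Nat.lt_succ_iff.1 i.2
    have hi' : (i : ℕ) < a * (k + 1) :=
      lt_of_le_of_lt hi (Nat.mul_lt_mul_of_pos_left (by omega) ha)
    change boxShift m (boxCoeff k Γ i) ∈ W
    rw [boxShift_boxCoeff hΓ hi']
    refine W.sum_mem fun s hs => W.smul_mem _ (hmem _ ?_)
    have := Finset.HasAntidiagonal.mem_antidiagonal.1 hs
    omega
  refine ⟨_, Finset.mem_Icc.2 ⟨?_, ?_⟩, e, he, heW⟩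
  · have h1 := linearIndependent_boxCoeff ha hD (hΓ l) h0
    have h2 : Submodule.span ℂ (Set.range fun j : Fin (D + 1) => boxCoeff k Γ (a * j)) ≤ W := by
      rw [Submodule.span_le]
      rintro _ ⟨j, rfl⟩
      exact hmem _ (Nat.mul_le_mul_left a (Nat.lt_succ_iff.1 j.2))
    have h3 := Submodule.finrank_mono h2
    rwa [finrank_span_eq_card h1, Fintype.card_fin] at h3
  · simpa using Submodule.finrank_le W

end ShiftStable

section FiniteType
open Filter Asymptotics ComplexConjugate

variable {n k : ℕ}

/-- `c` is the array of Taylor coefficients of `r` at `p`, up to order `k`. -/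
def IsTaylorAt (r : (Fin n → ℂ) → ℝ) (p : Fin n → ℂ)
    (c : (Fin n → Fin (k + 1)) → (Fin n → Fin (k + 1)) → ℂ) : Prop :=
  (fun ζ => (r (p + ζ) : ℂ) - sesq c (boxMonomial ζ) (boxMonomial ζ)) =O[𝓝 0]
    fun ζ => ‖ζ‖ ^ (k + 1)

lemma IsTaylorAt.comp_curve {r : (Fin n → ℂ) → ℝ} {p : Fin n → ℂ}
    {c : (Fin n → Fin (k + 1)) → (Fin n → Fin (k + 1)) → ℂ} (h : IsTaylorAt r p c)
    {u : ℂ → Fin n → ℂ} {a m : ℕ} (ha : 0 < a) (hu : ∀ i, (fun t => u t i) =O[𝓝 0] fun t => ‖t‖ ^ a)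
    (hm : m ≤ a * (k + 1)) :
    (fun t => (r (p + u t) : ℂ) - sesq c (boxMonomial (u t)) (boxMonomial (u t))) =O[𝓝 0]
      fun t => ‖t‖ ^ m := by
  have hu' : u =O[𝓝 0] fun t => ‖t‖ ^ a := isBigO_pi.2 hu
  have h0 : Tendsto u (𝓝 0) (𝓝 0) := by
    refine hu'.trans_tendsto ?_
    have hc : Continuous (fun t : ℂ => ‖t‖ ^ a) := by fun_prop
    simpa [ha.ne'] using hc.tendsto 0
  refine isBigO_norm_pow hm ((h.comp_tendsto h0).trans ?_)
  exact (hu'.norm_left.pow (k + 1)).congr_right fun t => (pow_mul _ _ _).symm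

lemma contDiffAt_comp_sub {r : (Fin n → ℂ) → ℝ} {p : Fin n → ℂ} {U : Set (Fin n → ℂ)}
    (hU : IsOpen U) (hp : p ∈ U) (hr : ContDiffOn ℝ (⊤ : ℕ∞) r U) {γ : ℂ → Fin n → ℂ}
    (hγ : γ ∈ Curves n p) : ContDiffAt ℝ (⊤ : ℕ∞) (fun t => r (γ t) - r p) 0 := by
  have h1 : ContDiffAt ℝ (⊤ : ℕ∞) γ 0 := (hγ.1.contDiffAt (n := (⊤ : ℕ∞))).restrict_scalars ℝ
  refine ContDiffAt.sub (ContDiffAt.comp (0 : ℂ) ?_ h1) contDiffAt_const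
  rw [hγ.2.1]
  exact hr.contDiffAt (hU.mem_nhds hp)

lemma contDiffAt_apply_sub {p : Fin n → ℂ} {γ : ℂ → Fin n → ℂ} (hγ : γ ∈ Curves n p) (i : Fin n) :
    ContDiffAt ℝ (⊤ : ℕ∞) (fun t => γ t i - p i) 0 :=
  ((((analyticAt_pi_iff.1 hγ.1 i).sub analyticAt_const).contDiffAt
    (n := (⊤ : ℕ∞))).restrict_scalars ℝ)

lemma eval_aeval_monomial_boxExponent (γ : Fin n → Polynomial ℂ) (t : ℂ)
    (α : Fin n → Fin (k + 1)) :
    (MvPolynomial.aeval γ (MvPolynomial.monomial (boxExponent α) (1 : ℂ))).eval t =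
      boxMonomial (fun i => (γ i).eval t) α := by
  rw [MvPolynomial.aeval_monomial, map_one, one_mul, Finsupp.prod_fintype _ _ (by simp),
    Polynomial.eval_prod]
  simp [boxMonomial]

lemma polynomial_mem_Curves {p : Fin n → ℂ} {γ : Fin n → Polynomial ℂ}
    (h0 : ∀ i, (γ i).coeff 0 = 0) {i : Fin n} {a : ℕ} (hi : (γ i).coeff a ≠ 0) :
    (fun t j => p j + (γ j).eval t) ∈ Curves n p := by
  refine ⟨analyticAt_pi_iff.2 fun j => ?_, ?_, fun h => hi ?_⟩
  · exact ((differentiable_const _).add (γ j).differentiable).analyticAt 0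
  · funext j
    simp [← Polynomial.coeff_zero_eq_eval_zero, h0]
  · refine Polynomial.X_pow_dvd_iff.1 (Polynomial.X_pow_dvd_iff_isBigO.2 ?_) a a.lt_succ_self
    refine (isBigO_zero _ _).congr' ?_ EventuallyEq.rfl
    filter_upwards [h] with t ht
    exact (by simpa using congrFun ht i : (γ i).eval t = 0).symm

lemma exists_sesq_ne_zero {M : Set (Fin n → ℂ)} {p : Fin n → ℂ} (hp : p ∈ M) {τ : ℝ} (hτ : 0 ≤ τ)
    (hΔ : Delta n M p = ENNReal.ofReal τ) (hk : τ ≤ k) {d : ℕ} (hd : τ ^ n < d)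
    {e : Fin d → BoxSpace n k} (he : IsShiftFrame e) :
    ∃ r U, IsOpen U ∧ p ∈ U ∧ ContDiffOn ℝ (⊤ : ℕ∞) r U ∧ (∀ z ∈ M ∩ U, r z = 0) ∧
      ∀ c, IsTaylorAt r p c → ∃ a b, sesq c (e a) (e b) ≠ 0 := by
  have hnot : ¬ CurveBound (frameIdeal e he) τ := fun H => by
    have := H.finrank_quotient_le hτ (X_pow_mem_frameIdeal he)
    rw [finrank_quotient_frameIdeal, Fintype.card_fin] at this
    linarith
  unfold CurveBound at hnot
  push Not at hnot
  obtain ⟨γ, a, h0, ⟨i, hi⟩, hdvd, hF⟩ := hnot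
  have ha : 0 < a := Nat.pos_of_ne_zero fun h => hi (h ▸ h0 i)
  set m := ⌊τ * a⌋₊ with hm
  set Γ : ℂ → Fin n → ℂ := fun t j => p j + (γ j).eval t with hΓ
  have hΓmem : Γ ∈ Curves n p := polynomial_mem_Curves h0 hi
  have hν : nuCurve Γ p ≤ a := by
    refine (iInf_le _ i).trans (not_lt.1 fun h => hi ?_)
    rw [natCast_lt_vOrder_iff (contDiffAt_apply_sub hΓmem i)] at h
    refine Polynomial.X_pow_dvd_iff.1 (Polynomial.X_pow_dvd_iff_isBigO.2 ?_) a a.lt_succ_self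
    simpa [hΓ] using h
  obtain ⟨r, ⟨U, hU, hpU, hr, hrM⟩, hlt⟩ : ∃ r ∈ IMp n M p,
      vOrder (fun t => r (Γ t) - r p) ≤ (m : ℕ) := by
    by_contra! H
    have h1 : ((m + 1 : ℕ) : ℝ≥0∞) / a ≤ ENNReal.ofReal τ := by
      rw [← hΔ]
      refine le_iSup₂_of_le Γ hΓmem (le_iInf₂ fun r hr => ENNReal.div_le_div ?_ hν)
      have hsm : ContDiffAt ℝ (⊤ : ℕ∞) (fun t => r (Γ t) - r p) 0 := by
        obtain ⟨U, hU, hpU, hr, -⟩ := hr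
        exact contDiffAt_comp_sub hU hpU hr hΓmem
      refine le_iInf₂ fun j hj => ?_
      have : (m : ℝ≥0∞) < j := (H r hr).trans_le (iInf₂_le j hj)
      exact_mod_cast Nat.succ_le_of_lt (by exact_mod_cast this)
    have ha' : (0 : ℝ) < a := by exact_mod_cast ha
    rw [ENNReal.div_le_iff (by exact_mod_cast ha.ne') (ENNReal.natCast_ne_top a),
      ← ENNReal.ofReal_natCast a, ← ENNReal.ofReal_mul hτ, ← ENNReal.ofReal_natCast,
      ENNReal.ofReal_le_ofReal_iff (by positivity)] at h1
    have := Nat.lt_floor_add_one (τ * a)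
    push_cast at h1
    linarith
  refine ⟨r, U, hU, hpU, hr, hrM, fun c hc => ?_⟩
  by_contra! H
  refine absurd hlt (not_le.2 ?_)
  rw [natCast_lt_vOrder_iff (contDiffAt_comp_sub hU hpU hr hΓmem)]
  have hma : m + 1 ≤ a * (k + 1) := by
    have h1 : m ≤ a * k := by
      rw [hm]
      refine Nat.floor_le_of_le ?_
      push_cast
      nlinarith [(Nat.cast_nonneg a : (0 : ℝ) ≤ a)]
    rw [mul_add]
    omega
  have h1 := hc.comp_curve (u := fun t j => (γ j).eval t) ha
    (fun j => Polynomial.X_pow_dvd_iff_isBigO.1 (hdvd j)) hma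
  have h2 := sesq_sub_isBigO (fun α => eval_mem_congrSubalgebra
    (P := MvPolynomial.aeval γ (MvPolynomial.monomial (boxExponent α) (1 : ℂ)))
    (Q := ∑ b, e b α • MvPolynomial.aeval γ (boxDual (e b))) (m := m + 1) (by
      have := hF _ (monomial_sub_mem_frameIdeal he α)
      simpa only [map_sub, map_sum, map_smul] using this)) c
  have h3 : ∀ t, sesq c (fun α => (∑ b, e b α • MvPolynomial.aeval γ (boxDual (e b))).eval t)
      (fun α => (∑ b, e b α • MvPolynomial.aeval γ (boxDual (e b))).eval t) = 0 := by
    intro t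
    have := sesq_sum c Finset.univ Finset.univ
      (fun b => (MvPolynomial.aeval γ (boxDual (e b))).eval t)
      (fun b => (MvPolynomial.aeval γ (boxDual (e b))).eval t) (fun b => e b) (fun b => e b)
    simp only [H, zero_mul, Finset.sum_const_zero] at this
    rw [← this]
    congr 1 <;> ext α <;> simp [Polynomial.eval_finsetSum, mul_comm]
  simp only [h3, sub_zero, eval_aeval_monomial_boxExponent] at h2
  have h4 := (h1.add h2).norm_left
  refine IsBigO.of_norm_left (h4.congr_left fun t => ?_)
  rw [sub_add_cancel, Complex.norm_real, hrM p ⟨hp, hpU⟩, sub_zero]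
  rfl

lemma exists_order_of_mem_Curves {p : Fin n → ℂ} {γ : ℂ → Fin n → ℂ} (hγ : γ ∈ Curves n p) :
    ∃ a : ℕ, 0 < a ∧ (∀ i, (fun t => γ t i - p i) =O[𝓝 0] fun t => ‖t‖ ^ a) ∧
      ∃ i, ¬ (fun t => γ t i - p i) =O[𝓝 0] fun t => ‖t‖ ^ (a + 1) := by
  classical
  have han : ∀ i, AnalyticAt ℂ (fun t => γ t i - p i) 0 := fun i =>
    (analyticAt_pi_iff.1 hγ.1 i).sub analyticAt_const
  have hex : ∃ b : ℕ, ∃ i, ¬ (fun t => γ t i - p i) =O[𝓝 0] fun t => ‖t‖ ^ b := by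
    by_contra! H
    refine hγ.2.2 ?_
    have h1 : ∀ i, ∀ᶠ t in 𝓝 0, γ t i - p i = 0 := fun i => by
      by_contra h
      obtain ⟨b, hb⟩ := (han i).exists_not_isBigO h
      exact hb (H b i)
    filter_upwards [eventually_all.2 h1] with t ht
    exact funext fun i => sub_eq_zero.1 (ht i)
  have h2 : 2 ≤ Nat.find hex := by
    refine (Nat.le_find_iff hex 2).2 fun b hb => ?_
    push Not
    intro i
    refine isBigO_norm_pow (m' := 1) (by omega) ?_
    have h3 := (han i).differentiableAt.isBigO_sub
    simpa [hγ.2.1] using h3.norm_right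
  refine ⟨Nat.find hex - 1, by omega, fun i => ?_, ?_⟩
  · have := Nat.find_min hex (m := Nat.find hex - 1) (by omega)
    push Not at this
    exact this i
  · rw [Nat.sub_add_cancel (by omega)]
    exact Nat.find_spec hex

lemma isBigO_of_lt_vOrder_div {M : Set (Fin n → ℂ)} {p : Fin n → ℂ} (hp : p ∈ M)
    {γ : ℂ → Fin n → ℂ} (hγ : γ ∈ Curves n p) {a N : ℕ} (ha : 0 < a)
    (hγa : ∀ i, (fun t => γ t i - p i) =O[𝓝 0] fun t => ‖t‖ ^ a)
    {r : (Fin n → ℂ) → ℝ} (hr : r ∈ IMp n M p)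
    (h : (N : ℝ≥0∞) < vOrder (fun t => r (γ t) - r p) / nuCurve γ p) :
    (fun t => (r (γ t) : ℂ)) =O[𝓝 0] fun t => ‖t‖ ^ (N * a + 1) := by
  obtain ⟨U, hU, hpU, hr, hrM⟩ := hr
  have hν : (a : ℝ≥0∞) ≤ nuCurve γ p := by
    refine le_iInf fun i => le_iInf₂ fun j hj => ?_
    have h1 := (natCast_lt_vOrder_iff (m := a - 1) (contDiffAt_apply_sub hγ i)).2
      (by rw [Nat.sub_add_cancel ha]; exact hγa i)
    have h2 : ((a - 1 : ℕ) : ℝ≥0∞) < j := h1.trans_le (iInf₂_le j hj)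
    have h3 : a - 1 < j := by exact_mod_cast h2
    exact_mod_cast (by omega : a ≤ j)
  have h1 : ((N * a : ℕ) : ℝ≥0∞) < vOrder (fun t => r (γ t) - r p) := by
    have h2 := h.trans_le (ENNReal.div_le_div_left hν _)
    rw [ENNReal.lt_div_iff_mul_lt (Or.inl (by exact_mod_cast ha.ne'))
      (Or.inl (ENNReal.natCast_ne_top a))] at h2
    exact_mod_cast h2
  rw [natCast_lt_vOrder_iff (contDiffAt_comp_sub hU hpU hr hγ), hrM p ⟨hp, hpU⟩] at h1
  refine IsBigO.of_norm_left (h1.norm_left.congr_left fun t => ?_)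
  rw [Complex.norm_real, sub_zero]

lemma sesq_boxCoeff_eq_zero {c : (Fin n → Fin (k + 1)) → (Fin n → Fin (k + 1)) → ℂ}
    {Γ : Fin n → Polynomial ℂ} {m : ℕ}
    (h : (fun t => sesq c (boxMonomial fun i => (Γ i).eval t)
      (boxMonomial fun i => (Γ i).eval t)) =O[𝓝 0] fun t => ‖t‖ ^ (m + 1))
    {i j : ℕ} (hij : i + j ≤ m) : sesq c (boxCoeff k Γ i) (boxCoeff k Γ j) = 0 := by
  obtain ⟨N, hN⟩ : ∃ N : ℕ, ∀ α : Fin n → Fin (k + 1), (∏ l, Γ l ^ (α l : ℕ)).natDegree < N := by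
    obtain ⟨N, hN⟩ := (Set.finite_range fun α : Fin n → Fin (k + 1) =>
      (∏ l, Γ l ^ (α l : ℕ)).natDegree).bddAbove
    exact ⟨N + 1, fun α => Nat.lt_succ_of_le (hN ⟨α, rfl⟩)⟩
  set N' := max N (m + 1)
  have h1 : ∀ t, (boxMonomial fun i => (Γ i).eval t) = fun α : Fin n → Fin (k + 1) =>
      ∑ i ∈ Finset.range N', t ^ i * boxCoeff k Γ i α := by
    intro t
    funext α
    have h2 := Polynomial.eval_eq_sum_range' ((hN α).trans_le (le_max_left N (m + 1))) t
    rw [Polynomial.eval_prod] at h2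
    simpa [boxMonomial, mul_comm] using h2
  simp only [h1, sesq_sum] at h
  have h3 := coeff_eq_zero_of_isBigO (Finset.range N' ×ˢ Finset.range N')
    (fun s => sesq c (boxCoeff k Γ s.1) (boxCoeff k Γ s.2)) (m := m) (s₀ := (i, j))
    (h.congr_left fun t => ?_) ?_ hij
  · exact h3
  · rw [Finset.sum_product]
    simp only [map_pow, mul_assoc]
  · simp only [Finset.mem_product, Finset.mem_range, N', lt_max_iff]
    omega

lemma exists_isShiftFrame_of_lt {M : Set (Fin n → ℂ)} {p : Fin n → ℂ} (hp : p ∈ M) {D : ℕ}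
    (hk : 2 * D ≤ k) {γ : ℂ → Fin n → ℂ} (hγ : γ ∈ Curves n p)
    (h : ∀ r ∈ IMp n M p,
      ((2 * D : ℕ) : ℝ≥0∞) < vOrder (fun t => r (γ t) - r p) / nuCurve γ p) :
    ∃ d ∈ Finset.Icc (D + 1) (Fintype.card (Fin n → Fin (k + 1))), ∃ e : Fin d → BoxSpace n k,
      IsShiftFrame e ∧
        ∀ r ∈ IMp n M p, ∀ c, IsTaylorAt r p c → ∀ a b, sesq c (e a) (e b) = 0 := by
  obtain ⟨a, ha, hγa, l, hl⟩ := exists_order_of_mem_Curves hγ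
  have han : ∀ i, AnalyticAt ℂ (fun t => γ t i - p i) 0 := fun i =>
    (analyticAt_pi_iff.1 hγ.1 i).sub analyticAt_const
  have hma : a + 1 ≤ 2 * D * a + 1 + a := by omega
  choose Γ hΓ using fun i => (han i).exists_polynomial_isBigO (2 * D * a + 1 + a)
  have hdvd : ∀ i, Polynomial.X ^ a ∣ Γ i := fun i => Polynomial.X_pow_dvd_iff_isBigO.2
    (((hγa i).sub (isBigO_norm_pow (by omega) (hΓ i))).congr_left fun t => by ring)
  have hcoeff : (Γ l).coeff a ≠ 0 := by
    intro h0
    have h1 : Polynomial.X ^ (a + 1) ∣ Γ l := Polynomial.X_pow_dvd_iff.2 fun j hj => by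
      rcases Nat.lt_succ_iff_lt_or_eq.1 hj with hj | rfl
      · exact Polynomial.X_pow_dvd_iff.1 (hdvd l) j hj
      · exact h0
    exact hl (((Polynomial.X_pow_dvd_iff_isBigO.1 h1).add
      (isBigO_norm_pow hma (hΓ l))).congr_left fun t => by ring)
  obtain ⟨d, hd, e, he, hspan⟩ := exists_isShiftFrame_of_curve ha (by omega : D ≤ k) hdvd hcoeff
  refine ⟨d, hd, e, he, fun r hr c hc b b' => ?_⟩
  have hm : 2 * D * a + 1 ≤ a * (k + 1) := by nlinarith
  have h1 := isBigO_of_lt_vOrder_div hp hγ ha hγa hr (h r hr)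
  have h2 := hc.comp_curve ha hγa hm
  have h3 := sesq_sub_isBigO (fun α => boxMonomial_mem_congrSubalgebra (k := k)
    (h := fun t => ‖t‖ ^ (2 * D * a + 1)) (u := fun t i => γ t i - p i)
    (v := fun t i => (Γ i).eval t) (fun i => mem_congrSubalgebra.2
      ⟨(han i).continuousAt.isBigO_one ℝ, (Γ i).continuous.continuousAt.isBigO_one ℝ,
        isBigO_norm_pow (by omega) (hΓ i)⟩) α) c
  have h4 : (fun t => sesq c (boxMonomial fun i => (Γ i).eval t)
      (boxMonomial fun i => (Γ i).eval t)) =O[𝓝 0] fun t => ‖t‖ ^ (2 * D * a + 1) := by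
    refine ((h1.sub h2).sub h3).congr_left fun t => ?_
    have : (p + fun i => γ t i - p i) = γ t := by
      funext i
      simp
    rw [this]
    ring
  let L := WithLp.linearEquiv 2 ℂ ((Fin n → Fin (k + 1)) → ℂ)
  have hspan' : ∀ b, (L (e b)) ∈ Submodule.span ℂ
      (Set.range fun i : Fin (a * D + 1) => L (boxCoeff k Γ i)) := fun b => by
    have := Submodule.mem_map_of_mem (f := L.toLinearMap) (hspan b)
    rwa [Submodule.map_span, ← Set.range_comp] at this
  refine sesq_eq_zero_of_mem_span (fun i j => ?_) (hspan' b) (hspan' b')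
  exact sesq_boxCoeff_eq_zero h4 (by have := i.2; have := j.2; nlinarith)

lemma eventually_forall_isShiftFrame {M : Set (Fin n → ℂ)} {p₀ : Fin n → ℂ} {d : ℕ}
    (H : ∀ e : Fin d → BoxSpace n k, IsShiftFrame e →
      ∃ r U, IsOpen U ∧ p₀ ∈ U ∧ ContDiffOn ℝ (⊤ : ℕ∞) r U ∧ (∀ z ∈ M ∩ U, r z = 0) ∧
        ∀ c, IsTaylorAt r p₀ c → ∃ a b, sesq c (e a) (e b) ≠ 0) :
    ∀ᶠ p in 𝓝 p₀, ∀ e : Fin d → BoxSpace n k, IsShiftFrame e →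
      ∃ r ∈ IMp n M p, ∃ c, IsTaylorAt r p c ∧ ∃ a b, sesq c (e a) (e b) ≠ 0 := by
  refine (isCompact_isShiftFrame n k d).eventually_forall_of_forall_eventually fun e he => ?_
  obtain ⟨r, U, hU, hpU, hr, hrM, hc⟩ := H e he
  obtain ⟨c, hcont, hT⟩ := exists_taylor_coeff hU hr k
  obtain ⟨a, b, hab⟩ := hc _ (hT p₀ hpU)
  have h1 : ContinuousAt (fun z : (Fin n → ℂ) × (Fin d → BoxSpace n k) =>
      sesq (c z.1) (z.2 a) (z.2 b)) (p₀, e) := by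
    unfold sesq
    refine tendsto_finsetSum _ fun α _ => tendsto_finsetSum _ fun β _ => ContinuousAt.mul ?_ ?_
    · exact ContinuousAt.fst'' (f := fun p => c p α β) ((hcont α β).continuousAt (hU.mem_nhds hpU))
    · have : Continuous fun z : (Fin n → ℂ) × (Fin d → BoxSpace n k) =>
          z.2 a α * conj (z.2 b β) := by fun_prop
      exact this.continuousAt
  filter_upwards [h1.eventually_ne hab, continuousAt_fst.eventually (hU.mem_nhds hpU)] with z hz hzU
  exact ⟨r, ⟨U, hU, hzU, hr, hrM⟩, c z.1, hT _ hzU, a, b, hz⟩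

end FiniteType

/-- If `p₀ ∈ M ⊆ ℂⁿ` is a point of finite type, then there is a neighborhood `V₀` of `p₀`
such that `Δ(M, p) ≤ 2 (Δ(M, p₀))ⁿ` for all `p ∈ M ∩ V₀`. -/
theorem finite_type_openness (n : ℕ) (M : Set (Fin n → ℂ)) (p₀ : Fin n → ℂ)
    (hp₀ : p₀ ∈ M) (hfin : Delta n M p₀ < ⊤) :
    ∃ V₀ : Set (Fin n → ℂ), IsOpen V₀ ∧ p₀ ∈ V₀ ∧
      ∀ p ∈ M ∩ V₀, Delta n M p ≤ 2 * (Delta n M p₀) ^ n := by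
  obtain ⟨τ, hτ, hΔ⟩ : ∃ τ : ℝ, 0 ≤ τ ∧ Delta n M p₀ = ENNReal.ofReal τ :=
    ⟨_, ENNReal.toReal_nonneg, (ENNReal.ofReal_toReal hfin.ne).symm⟩
  set D := ⌊τ ^ n⌋₊
  obtain ⟨k, hk, hkτ⟩ : ∃ k : ℕ, 2 * D ≤ k ∧ τ ≤ k :=
    ⟨max (2 * D) ⌈τ⌉₊, le_max_left _ _, (Nat.le_ceil τ).trans (by exact_mod_cast le_max_right _ _)⟩
  have hev : ∀ᶠ p in 𝓝 p₀, ∀ d ∈ Finset.Icc (D + 1) (Fintype.card (Fin n → Fin (k + 1))),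
      ∀ e : Fin d → BoxSpace n k, IsShiftFrame e →
        ∃ r ∈ IMp n M p, ∃ c, IsTaylorAt r p c ∧ ∃ a b, sesq c (e a) (e b) ≠ 0 := by
    refine (Filter.eventually_all_finset _).2 fun d hd => eventually_forall_isShiftFrame
      fun e he => exists_sesq_ne_zero hp₀ hτ hΔ hkτ ?_ he
    exact (Nat.lt_floor_add_one _).trans_le (by exact_mod_cast (Finset.mem_Icc.1 hd).1)
  obtain ⟨V₀, hV, hVo, hpV⟩ := eventually_nhds_iff.1 hev
  refine ⟨V₀, hVo, hpV, fun p hp => iSup₂_le fun γ hγ => ?_⟩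
  by_contra! hlt
  have hD : ((2 * D : ℕ) : ℝ≥0∞) ≤ 2 * Delta n M p₀ ^ n := by
    rw [hΔ, ← ENNReal.ofReal_pow hτ, Nat.cast_mul, Nat.cast_ofNat, ← ENNReal.ofReal_natCast]
    gcongr
    exact Nat.floor_le (by positivity)
  obtain ⟨d, hd, e, he, h0⟩ := exists_isShiftFrame_of_lt hp.1 hk hγ fun r hr =>
    (hD.trans_lt hlt).trans_le (iInf₂_le r hr)
  obtain ⟨r, hr, c, hc, a, b, hab⟩ := hV p hp.2 d hd e he
  exact hab (h0 r hr c hc a b)
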